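/- arXiv:1304.4135 — 3 statements merged into one kernel-verified Lean document; each statement's English description precedes it below -/
import Mathlib

section
/- Let Ω := {(t,x) ∈ ℝ × ℝ³ : |x| < t} be the open forward light cone and let v : Ω → ℝ be twice continuously differentiable and satisfy the cubic focusing wave equation (−∂_t² + Δ_x)v(t,x) + v(t,x)³ = 0 on Ω. Define u on the backward light cone Ω' := {(T,X) ∈ ℝ × ℝ³ : T < 0, |X| < −T} by u(T,X) := (T² − |X|²)^{−1} · v(−T/(T² − |X|²), X/(T² − |X|²)). Then u is twice continuously differentiable on Ω' and satisfies (−∂_T² + Δ_X)u(T,X) + u(T,X)³ = 0 on Ω'. (Conformal invariance of the cubic wave equation under the Kelvin inversion.) -/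
noncomputable section

/-- Spacetime `ℝ × ℝ³`. -/
abbrev Spc : Type := ℝ × EuclideanSpace ℝ (Fin 3)

/-- Directional derivative of `v : ℝ × ℝ³ → ℝ` in the direction `w`. -/
noncomputable def dirDeriv (w : Spc) (v : Spc → ℝ) (p : Spc) : ℝ := fderiv ℝ v p w

/-- Second time derivative `∂_t²`. -/
noncomputable def dtt (v : Spc → ℝ) : Spc → ℝ := dirDeriv (1, 0) (dirDeriv (1, 0) v)

/-- Spatial Laplacian `Δ_x = ∑_j ∂_j∂_j`. -/
noncomputable def lap (v : Spc → ℝ) (p : Spc) : ℝ :=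
  ∑ j : Fin 3, dirDeriv (0, EuclideanSpace.single j 1)
    (dirDeriv (0, EuclideanSpace.single j 1) v) p

open Filter Topology

/-- The Minkowski bilinear form `T w₀ - ⟪X, w'⟫`, as a functional in its second argument. -/
def minkowskiForm (p : Spc) : Spc →L[ℝ] ℝ :=
  p.1 • ContinuousLinearMap.fst ℝ ℝ (EuclideanSpace ℝ (Fin 3)) -
    (innerSL ℝ p.2).comp (ContinuousLinearMap.snd ℝ ℝ (EuclideanSpace ℝ (Fin 3)))

/-- Time reflection `(T, X) ↦ (-T, X)`. -/
def timeReflection : Spc →L[ℝ] Spc :=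
  (-ContinuousLinearMap.fst ℝ ℝ (EuclideanSpace ℝ (Fin 3))).prod
    (ContinuousLinearMap.snd ℝ ℝ (EuclideanSpace ℝ (Fin 3)))

/-- The inverse Lorentzian square `(T² - |X|²)⁻¹`. -/
def kelvinFactor (p : Spc) : ℝ := (p.1 ^ 2 - ‖p.2‖ ^ 2)⁻¹

/-- The Kelvin inversion. -/
def kelvinMap (p : Spc) : Spc := kelvinFactor p • timeReflection p

lemma minkowskiForm_apply (p w : Spc) :
    minkowskiForm p w = p.1 * w.1 - inner ℝ p.2 w.2 := by
  simp [minkowskiForm]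

lemma timeReflection_apply (p : Spc) : timeReflection p = (-p.1, p.2) := by
  simp [timeReflection]

lemma hasFDerivAt_minkowskiForm_left (w p : Spc) :
    HasFDerivAt (fun q => minkowskiForm q w) (minkowskiForm w) p := by
  have h : (fun q => minkowskiForm q w) = minkowskiForm w := by
    funext q
    simp only [minkowskiForm_apply, real_inner_comm, mul_comm]
  rw [h]
  exact (minkowskiForm w).hasFDerivAt

lemma hasFDerivAt_kelvinFactor {p : Spc} (hp : p.1 ^ 2 - ‖p.2‖ ^ 2 ≠ 0) :
    HasFDerivAt kelvinFactor ((-2 * kelvinFactor p ^ 2) • minkowskiForm p) p := by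
  have h1 : HasFDerivAt (fun q : Spc => q.1 ^ 2 - ‖q.2‖ ^ 2) ((2 : ℝ) • minkowskiForm p) p := by
    have ha : HasFDerivAt (fun q : Spc => q.1)
      (ContinuousLinearMap.fst ℝ ℝ (EuclideanSpace ℝ (Fin 3))) p := hasFDerivAt_fst
    have hb : HasFDerivAt (fun q : Spc => q.2)
      (ContinuousLinearMap.snd ℝ ℝ (EuclideanSpace ℝ (Fin 3))) p := hasFDerivAt_snd
    refine ((ha.pow 2).sub hb.norm_sq).congr_fderiv ?_
    refine ContinuousLinearMap.ext fun w => ?_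
    simp [minkowskiForm_apply]
    ring
  have h2 := (hasDerivAt_inv hp).comp_hasFDerivAt p h1
  refine h2.congr_fderiv ?_
  refine ContinuousLinearMap.ext fun w => ?_
  simp [kelvinFactor]
  ring

lemma hasFDerivAt_kelvinMap {p : Spc} (hp : p.1 ^ 2 - ‖p.2‖ ^ 2 ≠ 0) :
    HasFDerivAt kelvinMap (kelvinFactor p • timeReflection +
      ((-2 * kelvinFactor p ^ 2) • minkowskiForm p).smulRight (timeReflection p)) p :=
  (hasFDerivAt_kelvinFactor hp).smul timeReflection.hasFDerivAt

/-- The Kelvin transform `σ · (v ∘ φ)` of `v`. -/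
def kelvinTransform (v : Spc → ℝ) (p : Spc) : ℝ := kelvinFactor p * v (kelvinMap p)

lemma dirDeriv_kelvinTransform {v : Spc → ℝ} {p : Spc} (hp : p.1 ^ 2 - ‖p.2‖ ^ 2 ≠ 0)
    (hv : DifferentiableAt ℝ v (kelvinMap p)) (w : Spc) :
    dirDeriv w (kelvinTransform v) p =
      (-2 * minkowskiForm p w * kelvinFactor p ^ 2) * v (kelvinMap p) +
      fderiv ℝ v (kelvinMap p) (kelvinFactor p ^ 2 • timeReflection w +
        (-2 * minkowskiForm p w * kelvinFactor p ^ 3) • timeReflection p) := by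
  have h := (hasFDerivAt_kelvinFactor hp).mul
    (hv.hasFDerivAt.comp p (hasFDerivAt_kelvinMap hp))
  have h' : HasFDerivAt (kelvinTransform v) _ p := h
  rw [dirDeriv, h'.fderiv]
  simp
  ring

lemma dirDeriv_dirDeriv_kelvinTransform {v : Spc → ℝ} {p : Spc}
    (hp : p.1 ^ 2 - ‖p.2‖ ^ 2 ≠ 0) (hv : ContDiffAt ℝ 2 v (kelvinMap p)) (w : Spc) :
    dirDeriv w (dirDeriv w (kelvinTransform v)) p =
      (-2 * minkowskiForm w w * kelvinFactor p ^ 2 +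
        8 * minkowskiForm p w ^ 2 * kelvinFactor p ^ 3) * v (kelvinMap p) -
      8 * minkowskiForm p w * kelvinFactor p ^ 3 *
        fderiv ℝ v (kelvinMap p) (timeReflection w) +
      (-2 * minkowskiForm w w * kelvinFactor p ^ 3 +
        16 * minkowskiForm p w ^ 2 * kelvinFactor p ^ 4) *
        fderiv ℝ v (kelvinMap p) (timeReflection p) +
      kelvinFactor p ^ 3 *
        fderiv ℝ (fderiv ℝ v) (kelvinMap p) (timeReflection w) (timeReflection w) -
      4 * minkowskiForm p w * kelvinFactor p ^ 4 *
        fderiv ℝ (fderiv ℝ v) (kelvinMap p) (timeReflection w) (timeReflection p) +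
      4 * minkowskiForm p w ^ 2 * kelvinFactor p ^ 5 *
        fderiv ℝ (fderiv ℝ v) (kelvinMap p) (timeReflection p) (timeReflection p) := by
  have hφ := hasFDerivAt_kelvinMap hp
  have hσ := hasFDerivAt_kelvinFactor hp
  have hB := hasFDerivAt_minkowskiForm_left w p
  have hA := timeReflection.hasFDerivAt (x := p)
  have hev : dirDeriv w (kelvinTransform v) =ᶠ[𝓝 p] fun q =>
      (-2 * minkowskiForm q w * kelvinFactor q ^ 2) * v (kelvinMap q) +
      fderiv ℝ v (kelvinMap q) (kelvinFactor q ^ 2 • timeReflection w +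
        (-2 * minkowskiForm q w * kelvinFactor q ^ 3) • timeReflection q) := by
    have h1 : ∀ᶠ q : Spc in 𝓝 p, q.1 ^ 2 - ‖q.2‖ ^ 2 ≠ 0 :=
      ContinuousAt.eventually_ne (by fun_prop) hp
    have h2 : ∀ᶠ q in 𝓝 p, ContDiffAt ℝ 2 v (kelvinMap q) :=
      hφ.continuousAt.eventually (hv.eventually (by simp))
    filter_upwards [h1, h2] with q hq hq2
    exact dirDeriv_kelvinTransform hq (hq2.differentiableAt (by norm_num)) w
  have hvd := (hv.differentiableAt (by norm_num)).hasFDerivAt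
  have hvdd : HasFDerivAt (fderiv ℝ v) (fderiv ℝ (fderiv ℝ v) (kelvinMap p)) (kelvinMap p) :=
    ((hv.fderiv_right (m := 1) (by norm_num)).differentiableAt (by norm_num)).hasFDerivAt
  have hsymm : IsSymmSndFDerivAt ℝ v (kelvinMap p) := hv.isSymmSndFDerivAt (by simp)
  have hF := (((hB.const_mul (-2)).mul (hσ.pow 2)).mul (hvd.comp p hφ)).add
    ((hvdd.comp p hφ).clm_apply (((hσ.pow 2).smul_const (timeReflection w)).add
      (((hB.const_mul (-2)).mul (hσ.pow 3)).smul hA)))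
  rw [dirDeriv, hev.fderiv_eq]
  erw [hF.fderiv]
  have hs := hsymm.eq (timeReflection p) (timeReflection w)
  simp
  rw [hs]
  ring

lemma spc_eq_sum (x : EuclideanSpace ℝ (Fin 3)) (t : ℝ) :
    ((t, x) : Spc) = t • ((1, 0) : Spc) +
      ∑ j : Fin 3, x j • ((0, EuclideanSpace.single j 1) : Spc) := by
  ext i
  · simp [Fin.sum_univ_three]
  · fin_cases i <;> simp [Fin.sum_univ_three]

lemma wave_kelvinTransform {v : Spc → ℝ} {p : Spc}
    (hp : p.1 ^ 2 - ‖p.2‖ ^ 2 ≠ 0) (hv : ContDiffAt ℝ 2 v (kelvinMap p)) :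
    -dtt (kelvinTransform v) p + lap (kelvinTransform v) p =
      kelvinFactor p ^ 3 * (-dtt v (kelvinMap p) + lap v (kelvinMap p)) := by
  have hvdd : DifferentiableAt ℝ (fderiv ℝ v) (kelvinMap p) :=
    (hv.fderiv_right (m := 1) (by norm_num)).differentiableAt (by norm_num)
  have hdd (w : Spc) : dirDeriv w (dirDeriv w v) (kelvinMap p) =
      fderiv ℝ (fderiv ℝ v) (kelvinMap p) w w := by
    have h := hvdd.hasFDerivAt.clm_apply (hasFDerivAt_const w (kelvinMap p))
    have h' : HasFDerivAt (dirDeriv w v) _ (kelvinMap p) := h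
    rw [dirDeriv, h'.fderiv]
    simp
  have hσ : kelvinFactor p * (p.1 ^ 2 - (p.2 0 ^ 2 + p.2 1 ^ 2 + p.2 2 ^ 2)) = 1 := by
    have h : ‖p.2‖ ^ 2 = p.2 0 ^ 2 + p.2 1 ^ 2 + p.2 2 ^ 2 := by
      simp [EuclideanSpace.norm_sq_eq, Fin.sum_univ_three]
    rw [← h]
    exact inv_mul_cancel₀ hp
  have hR0 : timeReflection ((1, 0) : Spc) = -((1, 0) : Spc) := by
    simp [timeReflection_apply]
  have hRj (j : Fin 3) : timeReflection ((0, EuclideanSpace.single j 1) : Spc) =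
      (0, EuclideanSpace.single j 1) := by
    simp [timeReflection_apply]
  have hdecomp := spc_eq_sum p.2 (-p.1)
  rw [← timeReflection_apply, Fin.sum_univ_three] at hdecomp
  have hL := congrArg (fderiv ℝ v (kelvinMap p)) hdecomp
  have hM := congrArg
    (fun z => fderiv ℝ (fderiv ℝ v) (kelvinMap p) z (timeReflection p)) hdecomp
  simp only [map_add, map_smul, _root_.add_apply, _root_.smul_apply,
    smul_eq_mul] at hL hM
  simp only [dtt, lap, Fin.sum_univ_three, hdd, dirDeriv_dirDeriv_kelvinTransform hp hv, hR0, hRj,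
    minkowskiForm_apply, map_neg, _root_.neg_apply]
  simp [EuclideanSpace.inner_single_right]
  linear_combination (-8 * kelvinFactor p ^ 2 * v (kelvinMap p) -
      16 * kelvinFactor p ^ 3 * fderiv ℝ v (kelvinMap p) (timeReflection p) -
      4 * kelvinFactor p ^ 4 * fderiv ℝ (fderiv ℝ v) (kelvinMap p) (timeReflection p)
        (timeReflection p)) * hσ - 8 * kelvinFactor p ^ 3 * hL - 4 * kelvinFactor p ^ 4 * hM

/-- Conformal invariance of the cubic wave equation under the Kelvin inversion:
if `v` is a `C²` solution of `(-∂_t² + Δ)v + v³ = 0` on the forward light cone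
`{|x| < t}`, then `u(T,X) = (T²-|X|²)⁻¹ v(-T/(T²-|X|²), X/(T²-|X|²))` is a `C²`
solution of the same equation on the backward light cone `{T < 0, |X| < -T}`. -/
theorem stmt3 (v : Spc → ℝ)
    (hv : ContDiffOn ℝ 2 v {p : Spc | ‖p.2‖ < p.1})
    (heq : ∀ p ∈ {p : Spc | ‖p.2‖ < p.1}, -dtt v p + lap v p + (v p) ^ 3 = 0)
    (u : Spc → ℝ)
    (hu : u = fun p : Spc => (p.1 ^ 2 - ‖p.2‖ ^ 2)⁻¹ *
      v (-p.1 / (p.1 ^ 2 - ‖p.2‖ ^ 2), (p.1 ^ 2 - ‖p.2‖ ^ 2)⁻¹ • p.2)) :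
    ContDiffOn ℝ 2 u {p : Spc | p.1 < 0 ∧ ‖p.2‖ < -p.1} ∧
      ∀ p ∈ {p : Spc | p.1 < 0 ∧ ‖p.2‖ < -p.1}, -dtt u p + lap u p + (u p) ^ 3 = 0 := by
  have hu' : u = kelvinTransform v := by
    rw [hu]
    funext p
    simp only [kelvinTransform, kelvinMap, kelvinFactor, timeReflection_apply, Prod.smul_mk,
      smul_eq_mul, div_eq_inv_mul]
  have hcone : IsOpen {p : Spc | ‖p.2‖ < p.1} :=
    isOpen_lt (by fun_prop) (by fun_prop)
  have hpos {p : Spc} (hp : p.1 < 0 ∧ ‖p.2‖ < -p.1) : 0 < p.1 ^ 2 - ‖p.2‖ ^ 2 := by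
    nlinarith [norm_nonneg p.2]
  have hmaps {p : Spc} (hp : p.1 < 0 ∧ ‖p.2‖ < -p.1) :
      kelvinMap p ∈ {p : Spc | ‖p.2‖ < p.1} := by
    have hσ : 0 < kelvinFactor p := inv_pos.mpr (hpos hp)
    simp only [kelvinMap, timeReflection_apply, Prod.smul_mk, Set.mem_ofPred_eq, norm_smul,
      smul_eq_mul, Real.norm_of_nonneg hσ.le]
    exact mul_lt_mul_of_pos_left hp.2 hσ
  have hvAt {p : Spc} (hp : p.1 < 0 ∧ ‖p.2‖ < -p.1) : ContDiffAt ℝ 2 v (kelvinMap p) :=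
    hv.contDiffAt (hcone.mem_nhds (hmaps hp))
  rw [hu']
  refine ⟨fun p hp => ContDiffAt.contDiffWithinAt ?_, fun p hp => ?_⟩
  · have hσ : ContDiffAt ℝ 2 kelvinFactor p :=
      ((contDiffAt_fst.pow 2).sub (contDiffAt_snd.norm_sq ℝ)).inv (hpos hp).ne'
    exact hσ.mul ((hvAt hp).comp p (hσ.smul timeReflection.contDiff.contDiffAt))
  · rw [wave_kelvinTransform (hpos hp).ne' (hvAt hp)]
    simp only [kelvinTransform]
    linear_combination kelvinFactor p ^ 3 * heq _ (hmaps hp)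
end
end

section
/- Let u₁ : cl(B) → ℂ be twice continuously differentiable and u₂ : cl(B) → ℂ be continuously differentiable on the closed unit ball of ℝ³. Define f₁(ξ) := −ξ^j ∂_j u₁(ξ) − u₁(ξ) + u₂(ξ) and f₂(ξ) := Δu₁(ξ) − ξ^j ∂_j u₂(ξ) − 2u₂(ξ). Then Re[ ∫_B ∂_k f₁(ξ) · conj(∂^k u₁(ξ)) dξ + ∫_{∂B} f₁(ω) · conj(u₁(ω)) dσ(ω) + ∫_B f₂(ξ) · conj(u₂(ξ)) dξ ] ≤ −(1/2) [ ∫_B |∇u₁(ξ)|² dξ + ∫_{∂B} |u₁(ω)|² dσ(ω) + ∫_B |u₂(ξ)|² dξ ]. (Dissipativity estimate Re(L̃₀u | u) ≤ −(1/2)‖u‖² for the free generator in similarity coordinates.) -/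
open MeasureTheory Metric

noncomputable section

/-- The closed unit ball in `ℝ³`. -/
abbrev CB : Set (EuclideanSpace ℝ (Fin 3)) := closedBall 0 1

/-- Partial derivative `∂_k` (within the closed ball). -/
noncomputable def pd (u : EuclideanSpace ℝ (Fin 3) → ℂ)
    (ξ : EuclideanSpace ℝ (Fin 3)) (k : Fin 3) : ℂ :=
  fderivWithin ℝ u CB ξ (EuclideanSpace.single k 1)

/-- Laplacian `Δ = ∑_k ∂_k∂_k` (within the closed ball). -/
noncomputable def lapl (u : EuclideanSpace ℝ (Fin 3) → ℂ)
    (ξ : EuclideanSpace ℝ (Fin 3)) : ℂ :=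
  ∑ k : Fin 3, fderivWithin ℝ (fun y => pd u y k) CB ξ (EuclideanSpace.single k 1)

section

open Set Filter Topology Module

theorem tendsto_integral_radial_kernel {K : ℝ → ℝ} (hK : Continuous K) :
    Tendsto (fun n : ℕ => ∫ r in (0 : ℝ)..1, 4 * (n + 1) * (1 - r ^ (2 * (n + 1))) *
      r ^ (2 * n + 1) * K r) atTop (𝓝 (K 1)) := by
  have key : ∀ n : ℕ, ∫ r in (0 : ℝ)..1, 4 * (n + 1) * (1 - r ^ (2 * (n + 1))) *
      r ^ (2 * n + 1) * K r =
      ∫ s in (0 : ℝ)..1, 2 * (1 - s) * K (s ^ ((1 : ℝ) / ((2 * (n + 1) : ℕ) : ℝ))) := by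
    intro n
    have hc : Continuous fun s : ℝ => s ^ ((1 : ℝ) / ((2 * (n + 1) : ℕ) : ℝ)) :=
      Real.continuous_rpow_const (by positivity)
    have h := intervalIntegral.integral_comp_mul_deriv (a := 0) (b := 1)
      (f := fun r : ℝ => r ^ (2 * (n + 1)))
      (f' := fun r : ℝ => ((2 * (n + 1) : ℕ) : ℝ) * r ^ (2 * (n + 1) - 1))
      (g := fun s => 2 * (1 - s) * K (s ^ ((1 : ℝ) / ((2 * (n + 1) : ℕ) : ℝ))))
      (fun x _ => hasDerivAt_pow _ x) (by fun_prop) (by fun_prop)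
    simp only [one_pow, zero_pow (show 2 * (n + 1) ≠ 0 by omega)] at h
    rw [← h]
    refine intervalIntegral.integral_congr fun r hr => ?_
    rw [uIcc_of_le zero_le_one] at hr
    have h1 : (r ^ (2 * (n + 1))) ^ ((1 : ℝ) / ((2 * (n + 1) : ℕ) : ℝ)) = r := by
      rw [one_div]
      exact Real.pow_rpow_inv_natCast hr.1 (by omega)
    have h2 : 2 * (n + 1) - 1 = 2 * n + 1 := by omega
    simp only [Function.comp, h1, h2]
    push_cast
    ring
  have hlim : K 1 = ∫ s in (0 : ℝ)..1, 2 * (1 - s) * K 1 := by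
    rw [intervalIntegral.integral_mul_const, intervalIntegral.integral_const_mul,
      intervalIntegral.integral_sub (by simp) (by simp)]
    simp
    norm_num
  obtain ⟨C, hC⟩ := isCompact_Icc.exists_bound_of_continuousOn (s := Icc (0 : ℝ) 1)
    hK.continuousOn
  simp only [key]
  rw [hlim]
  refine intervalIntegral.tendsto_integral_filter_of_dominated_convergence (fun _ => 2 * C)
    ?_ ?_ (by simp) ?_
  · refine Eventually.of_forall fun n => ?_
    have hc : Continuous fun s : ℝ => s ^ ((1 : ℝ) / ((2 * (n + 1) : ℕ) : ℝ)) :=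
      Real.continuous_rpow_const (by positivity)
    exact Continuous.aestronglyMeasurable (by fun_prop)
  · refine Eventually.of_forall fun n => Eventually.of_forall fun s hs => ?_
    rw [uIoc_of_le zero_le_one] at hs
    have h1 := hC (s ^ ((1 : ℝ) / ((2 * (n + 1) : ℕ) : ℝ)))
      ⟨Real.rpow_nonneg hs.1.le _, Real.rpow_le_one hs.1.le hs.2 (by positivity)⟩
    rw [norm_mul, norm_mul, Real.norm_of_nonneg zero_le_two,
      Real.norm_of_nonneg (sub_nonneg.2 hs.2)]
    exact mul_le_mul (by linarith [hs.1]) h1 (norm_nonneg _) zero_le_two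
  · refine Eventually.of_forall fun s hs => ?_
    rw [uIoc_of_le zero_le_one] at hs
    refine Tendsto.const_mul _ ((hK.tendsto 1).comp ?_)
    have h1 : Tendsto (fun n : ℕ => (1 : ℝ) / ((2 * (n + 1) : ℕ) : ℝ)) atTop (𝓝 0) := by
      refine tendsto_one_div_atTop_nhds_zero_nat.comp
        (tendsto_atTop_mono (fun n => ?_) tendsto_id)
      simp only [id]; omega
    simpa using (tendsto_const_nhds (x := s)).rpow h1 (Or.inl hs.1.ne')

theorem hasFDerivAt_mul_sq_of_eq_zero {E : Type*} [NormedAddCommGroup E] [NormedSpace ℝ E]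
    {v ψ : E → ℝ} {C : ℝ} (hv : ∀ x, ‖v x‖ ≤ C) {x : E}
    (hψ : DifferentiableAt ℝ ψ x) (h0 : ψ x = 0) :
    HasFDerivAt (fun y => v y * ψ y ^ 2) (0 : E →L[ℝ] ℝ) x := by
  have h1 : ψ =O[𝓝 x] fun y => ‖y - x‖ := by
    simpa [h0] using hψ.isBigO_sub.norm_right
  have h2 : ψ =o[𝓝 x] fun _ => (1 : ℝ) := by
    rw [Asymptotics.isLittleO_one_iff, ← h0]
    exact hψ.continuousAt
  have h3 : v =O[𝓝 x] fun _ => (1 : ℝ) :=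
    Asymptotics.IsBigO.of_bound C (Eventually.of_forall fun y => by simpa using hv y)
  have h4 := (h3.mul_isLittleO (h2.mul_isBigO h1)).norm_right
  refine HasFDerivAt.of_isLittleO ?_
  simpa [h0, ← sq] using h4

variable {E : Type*} [NormedAddCommGroup E] [InnerProductSpace ℝ E] [FiniteDimensional ℝ E]
  [MeasurableSpace E] [BorelSpace E] (μ : Measure E) [μ.IsAddHaarMeasure]

theorem integral_eq_integral_Ioi_sphere [Nontrivial E] {f : E → ℝ} (hf : Integrable f μ) :
    ∫ x, f x ∂μ = ∫ r in Ioi (0 : ℝ), r ^ (finrank ℝ E - 1) *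
      ∫ ω : sphere (0 : E) 1, f (r • (ω : E)) ∂μ.toSphere := by
  have hmp := μ.measurePreserving_homeomorphUnitSphereProd
  have hme := (homeomorphUnitSphereProd E).measurableEmbedding
  let F : sphere (0 : E) 1 × Ioi (0 : ℝ) → ℝ := fun p => f ((p.2 : ℝ) • (p.1 : E))
  have hF : ∀ x : ({0}ᶜ : Set E), F (homeomorphUnitSphereProd E x) = f x := by
    intro x
    have hx : ‖(x : E)‖ ≠ 0 := norm_ne_zero_iff.2 x.2
    simp [F, homeomorphUnitSphereProd, homeomorphSphereProd, smul_smul, hx]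
  have hint : Integrable F (μ.toSphere.prod (.volumeIoiPow (finrank ℝ E - 1))) := by
    rw [← hmp.integrable_comp_emb hme]
    refine (Integrable.congr (f := fun x : ({0}ᶜ : Set E) => f x) ?_
      (Eventually.of_forall fun x => (hF x).symm))
    exact (integrableOn_iff_comap_subtypeVal (measurableSet_singleton _).compl).1 hf.integrableOn
  calc
    ∫ x, f x ∂μ = ∫ x : ({0}ᶜ : Set E), f x ∂(μ.comap (↑)) := by
      rw [integral_subtype_comap (measurableSet_singleton _).compl f,
        restrict_compl_singleton]
    _ = ∫ p, F p ∂μ.toSphere.prod (.volumeIoiPow (finrank ℝ E - 1)) := by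
      rw [← hmp.integral_comp hme]
      simp only [hF]
    _ = ∫ r : Ioi (0 : ℝ), ∫ ω, F (ω, r) ∂μ.toSphere ∂.volumeIoiPow (finrank ℝ E - 1) :=
      integral_prod_symm _ hint
    _ = _ := by
      simp only [Measure.volumeIoiPow, ENNReal.ofReal, F]
      rw [integral_withDensity_eq_integral_smul,
        integral_subtype_comap measurableSet_Ioi fun a : ℝ =>
          Real.toNNReal (a ^ (finrank ℝ E - 1)) •
            ∫ ω : sphere (0 : E) 1, f (a • (ω : E)) ∂μ.toSphere,
        setIntegral_congr_fun measurableSet_Ioi fun x hx => ?_]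
      · rw [NNReal.smul_def, Real.coe_toNNReal _ (pow_nonneg hx.out.le _), smul_eq_mul]
      · exact (measurable_subtype_coe.pow_const _).real_toNNReal

theorem integral_ball_fderivWithin_mul_sq {v : E → ℝ}
    (hv : ContDiffOn ℝ 1 v (closedBall 0 1)) {ψ : E → ℝ} (hψ : ContDiff ℝ 1 ψ)
    (h0 : ∀ x ∈ sphere (0 : E) 1, ψ x = 0) (e : E) :
    ∫ x in ball (0 : E) 1, fderivWithin ℝ v (closedBall 0 1) x e * ψ x ^ 2 ∂μ =
      ∫ x in ball (0 : E) 1, -2 * ψ x * fderiv ℝ ψ x e * v x ∂μ := by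
  have hK : IsCompact (closedBall (0 : E) 1) := isCompact_closedBall 0 1
  have hud : UniqueDiffOn ℝ (closedBall (0 : E) 1) :=
    uniqueDiffOn_convex (convex_closedBall 0 1) ⟨0, by simp [interior_closedBall]⟩
  obtain ⟨C, hC⟩ := hK.exists_bound_of_continuousOn hv.continuousOn
  let w : E → ℝ := (closedBall (0 : E) 1).indicator v
  have hw : ∀ x, ‖w x‖ ≤ C := by
    intro x
    by_cases hx : x ∈ closedBall (0 : E) 1
    · simpa [w, indicator_of_mem hx] using hC x hx
    · simpa [w, indicator_of_notMem hx] using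
        (norm_nonneg _).trans (hC 0 (mem_closedBall_self zero_le_one))
  let D : E → E →L[ℝ] ℝ := fderivWithin ℝ v (closedBall 0 1)
  have hD : ContinuousOn (fun x => D x e) (closedBall (0 : E) 1) :=
    (hv.continuousOn_fderivWithin hud le_rfl).clm_apply continuousOn_const
  have hdψ : Continuous fun x => fderiv ℝ ψ x e :=
    (hψ.continuous_fderiv one_ne_zero).clm_apply continuous_const
  let g' : E → E →L[ℝ] ℝ := (ball (0 : E) 1).indicator fun x =>
    v x • ((2 • ψ x ^ (2 - 1)) • fderiv ℝ ψ x) + ψ x ^ 2 • D x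
  have hg : ∀ x, HasFDerivAt (fun y => w y * ψ y ^ 2) (g' x) x := by
    intro x
    have hψx : HasFDerivAt ψ (fderiv ℝ ψ x) x := (hψ.differentiable one_ne_zero x).hasFDerivAt
    rcases lt_trichotomy ‖x‖ 1 with hx | hx | hx
    · have hxb : x ∈ ball (0 : E) 1 := by simpa using hx
      have hnhds : closedBall (0 : E) 1 ∈ 𝓝 x :=
        mem_of_superset (isOpen_ball.mem_nhds hxb) ball_subset_closedBall
      have hvx : HasFDerivAt v (D x) x :=
        ((hv.differentiableOn one_ne_zero x (ball_subset_closedBall hxb)).hasFDerivWithinAt).hasFDerivAt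
          hnhds
      have heq : (fun y => w y * ψ y ^ 2) =ᶠ[𝓝 x] fun y => v y * ψ y ^ 2 := by
        filter_upwards [hnhds] with y hy
        simp [w, indicator_of_mem hy]
      refine HasFDerivAt.congr_of_eventuallyEq ?_ heq
      simp only [g', indicator_of_mem hxb]
      exact hvx.mul (hψx.pow 2)
    · have hxb : x ∉ ball (0 : E) 1 := by simp [hx]
      simp only [g', indicator_of_notMem hxb]
      exact hasFDerivAt_mul_sq_of_eq_zero hw hψx.differentiableAt (h0 x (by simp [hx]))
    · have hxb : x ∉ ball (0 : E) 1 := by simp [hx.le]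
      have hnhds : (closedBall (0 : E) 1)ᶜ ∈ 𝓝 x :=
        isClosed_closedBall.isOpen_compl.mem_nhds (by simp [hx])
      have heq : (fun y => w y * ψ y ^ 2) =ᶠ[𝓝 x] fun _ => 0 := by
        filter_upwards [hnhds] with y hy
        simp [w, indicator_of_notMem hy]
      simp only [g', indicator_of_notMem hxb]
      exact (hasFDerivAt_const _ _).congr_of_eventuallyEq heq
  have hi1 : IntegrableOn (fun x => D x e * ψ x ^ 2) (ball (0 : E) 1) μ :=
    ((hD.mul (hψ.continuous.pow 2).continuousOn).integrableOn_compact hK).mono_set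
      ball_subset_closedBall
  have hi2 : IntegrableOn (fun x => -2 * ψ x * fderiv ℝ ψ x e * v x) (ball (0 : E) 1) μ :=
    ((((continuous_const.mul hψ.continuous).mul hdψ).continuousOn.mul
      hv.continuousOn).integrableOn_compact hK).mono_set ball_subset_closedBall
  have hg'e : (fun x => g' x e) = (ball (0 : E) 1).indicator
      (fun x => D x e * ψ x ^ 2 - -2 * ψ x * fderiv ℝ ψ x e * v x) := by
    ext x
    by_cases hx : x ∈ ball (0 : E) 1
    · simp only [g', indicator_of_mem hx]
      simp
      ring
    · simp [g', indicator_of_notMem hx]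
  have hint : Integrable (fun x => g' x e) μ := by
    rw [hg'e]
    exact (hi1.sub hi2).integrable_indicator measurableSet_ball
  have hgint : Integrable (fun y => w y * ψ y ^ 2) μ := by
    have h : IntegrableOn (fun y => v y * ψ y ^ 2) (closedBall (0 : E) 1) μ :=
      (hv.continuousOn.mul (hψ.continuous.pow 2).continuousOn).integrableOn_compact hK
    refine (h.integrable_indicator measurableSet_closedBall).congr (Eventually.of_forall fun y => ?_)
    by_cases hy : y ∈ closedBall (0 : E) 1
    · simp [w, hy]
    · simp [w, hy]
  have hzero : ∫ x, g' x e ∂μ = 0 := by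
    have := integral_bilinear_hasFDerivAt_right_eq_neg_left_of_integrable (μ := μ) (v := e)
      (B := ContinuousLinearMap.mul ℝ ℝ) (f := fun _ : E => (1 : ℝ)) (f' := fun _ => 0)
      (g := fun y => w y * ψ y ^ 2) (g' := g') (by simp) (by simpa using hint)
      (by simpa using hgint) (fun x _ => hasFDerivAt_const _ _) (fun x _ => hg x)
    simpa using this
  rw [hg'e, integral_indicator measurableSet_ball, integral_sub hi1 hi2] at hzero
  exact sub_eq_zero.1 hzero

theorem tendsto_integral_ball_radial_kernel [Nontrivial E] {p : E → ℝ}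
    (hp : ContinuousOn p (closedBall 0 1)) (e : E) :
    Tendsto (fun n : ℕ => ∫ x in ball (0 : E) 1,
      4 * (n + 1) * (1 - ‖x‖ ^ (2 * (n + 1))) * ‖x‖ ^ (2 * n) * (inner ℝ x e * p x) ∂μ) atTop
      (𝓝 (∫ ω : sphere (0 : E) 1, inner ℝ (ω : E) e * p ω ∂μ.toSphere)) := by
  obtain ⟨q, hq⟩ := ContinuousMap.exists_restrict_eq (isClosed_closedBall (x := (0 : E)) (ε := 1))
    ⟨_, hp.domRestrict⟩
  have hqp : ∀ x ∈ closedBall (0 : E) 1, p x = q x := fun x hx =>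
    (congrArg (fun F : C(closedBall (0 : E) 1, ℝ) => F ⟨x, hx⟩) hq).symm
  let K : ℝ → ℝ := fun r => r ^ (finrank ℝ E - 1) *
    ∫ ω : sphere (0 : E) 1, inner ℝ (ω : E) e * q (r • (ω : E)) ∂μ.toSphere
  have hK : Continuous K := by
    refine (continuous_pow _).mul ?_
    have := continuous_parametric_integral_of_continuous (μ := μ.toSphere)
      (f := fun (r : ℝ) (ω : sphere (0 : E) 1) => inner ℝ (ω : E) e * q (r • (ω : E))) (by fun_prop)
      (s := univ) isCompact_univ
    simpa using this
  have hK1 : K 1 = ∫ ω : sphere (0 : E) 1, inner ℝ (ω : E) e * p ω ∂μ.toSphere := by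
    simp only [K, one_pow, one_mul, one_smul]
    exact integral_congr_ae (Eventually.of_forall fun ω => by
      simp only [hqp ω (sphere_subset_closedBall ω.2)])
  rw [← hK1]
  refine (tendsto_integral_radial_kernel hK).congr fun n => ?_
  let f : E → ℝ := fun x =>
    4 * (n + 1) * (1 - ‖x‖ ^ (2 * (n + 1))) * ‖x‖ ^ (2 * n) * (inner ℝ x e * q x)
  have hf : Continuous f := by fun_prop
  have hfi : IntegrableOn f (ball (0 : E) 1) μ :=
    (hf.continuousOn.integrableOn_compact (isCompact_closedBall 0 1)).mono_set
      ball_subset_closedBall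
  calc
    _ = ∫ r in Ioo (0 : ℝ) 1, 4 * (n + 1) * (1 - r ^ (2 * (n + 1))) * r ^ (2 * n + 1) * K r := by
      rw [intervalIntegral.integral_of_le zero_le_one, integral_Ioc_eq_integral_Ioo]
    _ = ∫ r in Ioi (0 : ℝ), (Ioo (0 : ℝ) 1).indicator (fun r =>
          4 * (n + 1) * (1 - r ^ (2 * (n + 1))) * r ^ (2 * n + 1) * K r) r := by
      rw [setIntegral_indicator measurableSet_Ioo, inter_eq_self_of_subset_right Ioo_subset_Ioi_self]
    _ = ∫ r in Ioi (0 : ℝ), r ^ (finrank ℝ E - 1) *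
          ∫ ω : sphere (0 : E) 1, (ball (0 : E) 1).indicator f (r • (ω : E)) ∂μ.toSphere := by
      refine setIntegral_congr_fun measurableSet_Ioi fun r (hr : 0 < r) => ?_
      have hn : ∀ ω : sphere (0 : E) 1, ‖r • (ω : E)‖ = r := fun ω => by
        simp [norm_smul, abs_of_pos hr]
      by_cases hr1 : r < 1
      · have h1 : ∀ ω : sphere (0 : E) 1, (ball (0 : E) 1).indicator f (r • (ω : E)) =
            (4 * (n + 1) * (1 - r ^ (2 * (n + 1))) * r ^ (2 * n) * r) *
              (inner ℝ (ω : E) e * q (r • (ω : E))) := by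
          intro ω
          rw [indicator_of_mem (by simpa [hn] using hr1)]
          simp only [f, hn, real_inner_smul_left]
          ring
        simp only [h1, integral_const_mul, indicator_of_mem (show r ∈ Ioo (0 : ℝ) 1 from ⟨hr, hr1⟩),
          K]
        ring
      · have h1 : ∀ ω : sphere (0 : E) 1, (ball (0 : E) 1).indicator f (r • (ω : E)) = 0 :=
          fun ω => indicator_of_notMem (by simpa [hn] using hr1) _
        simp [h1, hr1]
    _ = ∫ x in ball (0 : E) 1, f x ∂μ := by
      rw [← integral_indicator measurableSet_ball,
        integral_eq_integral_Ioi_sphere μ (hfi.integrable_indicator measurableSet_ball)]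
    _ = _ := setIntegral_congr_fun measurableSet_ball fun x hx => by
      simp only [f, hqp x (ball_subset_closedBall hx)]

/-- The Gauss-Green formula on the unit ball. -/
theorem integral_ball_fderivWithin [Nontrivial E] {v : E → ℝ}
    (hv : ContDiffOn ℝ 1 v (closedBall 0 1)) (e : E) :
    ∫ x in ball (0 : E) 1, fderivWithin ℝ v (closedBall 0 1) x e ∂μ =
      ∫ ω : sphere (0 : E) 1, inner ℝ (ω : E) e * v ω ∂μ.toSphere := by
  have hud : UniqueDiffOn ℝ (closedBall (0 : E) 1) :=
    uniqueDiffOn_convex (convex_closedBall 0 1) ⟨0, by simp [interior_closedBall]⟩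
  have hD : ContinuousOn (fun x => fderivWithin ℝ v (closedBall 0 1) x e) (closedBall (0 : E) 1) :=
    (hv.continuousOn_fderivWithin hud le_rfl).clm_apply continuousOn_const
  have hi : IntegrableOn (fun x => fderivWithin ℝ v (closedBall 0 1) x e) (ball (0 : E) 1) μ :=
    (hD.integrableOn_compact (isCompact_closedBall 0 1)).mono_set ball_subset_closedBall
  have hψ' : ∀ (n : ℕ) (x : E), HasFDerivAt (fun x : E => 1 - (‖x‖ ^ 2) ^ (n + 1))
      (-((((n : ℝ) + 1) * (‖x‖ ^ 2) ^ n) • (2 • innerSL ℝ x))) x := fun n x => by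
    simpa using ((hasStrictFDerivAt_norm_sq x).hasFDerivAt.pow (n + 1)).const_sub 1
  have hker : Tendsto (fun n : ℕ => ∫ x in ball (0 : E) 1,
      fderivWithin ℝ v (closedBall 0 1) x e * (1 - (‖x‖ ^ 2) ^ (n + 1)) ^ 2 ∂μ) atTop
      (𝓝 (∫ ω : sphere (0 : E) 1, inner ℝ (ω : E) e * v ω ∂μ.toSphere)) := by
    refine (tendsto_integral_ball_radial_kernel μ hv.continuousOn e).congr fun n => ?_
    rw [integral_ball_fderivWithin_mul_sq μ hv
      (contDiff_const.sub ((contDiff_norm_sq ℝ).pow (n + 1)))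
      (fun x hx => by simp [mem_sphere_zero_iff_norm.1 hx]) e]
    refine setIntegral_congr_fun measurableSet_ball fun x _ => ?_
    simp only [(hψ' n x).fderiv, pow_mul]
    simp
    ring
  refine tendsto_nhds_unique ?_ hker
  refine tendsto_integral_of_dominated_convergence
    (fun x => ‖fderivWithin ℝ v (closedBall 0 1) x e‖) (fun n => ?_) hi.norm (fun n => ?_) ?_
  · exact hi.aestronglyMeasurable.mul (Continuous.aestronglyMeasurable (by fun_prop))
  · filter_upwards [ae_restrict_mem measurableSet_ball] with x hx
    have hx' : ‖x‖ ^ 2 ≤ 1 := pow_le_one₀ (norm_nonneg _) (mem_ball_zero_iff.1 hx).le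
    have h1 : (‖x‖ ^ 2) ^ (n + 1) ≤ 1 := pow_le_one₀ (by positivity) hx'
    have h2 : 0 ≤ (‖x‖ ^ 2) ^ (n + 1) := by positivity
    rw [norm_mul]
    refine mul_le_of_le_one_right (norm_nonneg _) ?_
    rw [Real.norm_of_nonneg (sq_nonneg _)]
    exact pow_le_one₀ (by linarith) (by linarith)
  · filter_upwards [ae_restrict_mem measurableSet_ball] with x hx
    have hx' : ‖x‖ ^ 2 < 1 := pow_lt_one₀ (norm_nonneg _) (mem_ball_zero_iff.1 hx) two_ne_zero
    have h := (tendsto_pow_atTop_nhds_zero_of_lt_one (by positivity) hx').comp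
      (tendsto_add_atTop_nat 1)
    simpa using (((tendsto_const_nhds (x := (1 : ℝ))).sub h).pow 2).const_mul
      (fderivWithin ℝ v (closedBall 0 1) x e)

theorem uniqueDiffOn_CB : UniqueDiffOn ℝ CB :=
  uniqueDiffOn_convex (convex_closedBall 0 1) ⟨0, by simp [interior_closedBall]⟩

theorem ContDiffOn.pd_CB {m n : WithTop ℕ∞} {u : EuclideanSpace ℝ (Fin 3) → ℂ}
    (hu : ContDiffOn ℝ n u CB) (hmn : m + 1 ≤ n) (k : Fin 3) :
    ContDiffOn ℝ m (fun x => pd u x k) CB :=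
  (hu.fderivWithin uniqueDiffOn_CB hmn).clm_apply contDiffOn_const

theorem pd_pd_comm {u : EuclideanSpace ℝ (Fin 3) → ℂ} (hu : ContDiffOn ℝ 2 u CB)
    {x : EuclideanSpace ℝ (Fin 3)} (hx : x ∈ CB) (j k : Fin 3) :
    pd (fun y => pd u y j) x k = pd (fun y => pd u y k) x j := by
  have hd : DifferentiableWithinAt ℝ (fderivWithin ℝ u CB) CB x :=
    (hu.fderivWithin uniqueDiffOn_CB (m := 1) (by norm_num)).differentiableOn one_ne_zero x hx
  have hpd : ∀ i l : Fin 3, pd (fun y => pd u y i) x l =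
      fderivWithin ℝ (fderivWithin ℝ u CB) CB x (EuclideanSpace.single l 1)
        (EuclideanSpace.single i 1) := by
    intro i l
    unfold pd
    rw [fderivWithin_clm_apply (uniqueDiffOn_CB x hx) hd (differentiableWithinAt_const _)]
    simp
  have hsymm := (hu x hx).isSymmSndFDerivWithinAt (by simp) uniqueDiffOn_CB
    (by rw [interior_closedBall _ one_ne_zero, closure_ball _ one_ne_zero]; exact hx) hx
  rw [hpd, hpd, hsymm.eq]

/-- The energy flux: its divergence is the density of `(L̃₀u|u)` up to the damping terms. -/
def energyFlux (u₁ u₂ : EuclideanSpace ℝ (Fin 3) → ℂ) (k : Fin 3)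
    (x : EuclideanSpace ℝ (Fin 3)) : ℝ :=
  inner ℝ (u₂ x) (pd u₁ x k) - (1 / 2) * (x k * ((∑ j, ‖pd u₁ x j‖ ^ 2) + ‖u₂ x‖ ^ 2))

section

variable {u₁ u₂ : EuclideanSpace ℝ (Fin 3) → ℂ}

theorem contDiffOn_energyFlux (hu₁ : ContDiffOn ℝ 2 u₁ CB) (hu₂ : ContDiffOn ℝ 1 u₂ CB)
    (k : Fin 3) : ContDiffOn ℝ 1 (energyFlux u₁ u₂ k) CB := by
  have hg : ∀ j, ContDiffOn ℝ 1 (fun x => pd u₁ x j) CB := hu₁.pd_CB (by norm_num)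
  refine (hu₂.inner ℝ (hg k)).sub (contDiffOn_const.mul (ContDiffOn.mul ?_
    ((ContDiffOn.sum fun j _ => (hg j).norm_sq ℝ).add (hu₂.norm_sq ℝ))))
  exact (EuclideanSpace.proj k : EuclideanSpace ℝ (Fin 3) →L[ℝ] ℝ).contDiff.contDiffOn

theorem fderivWithin_energyFlux (hu₁ : ContDiffOn ℝ 2 u₁ CB) (hu₂ : ContDiffOn ℝ 1 u₂ CB)
    {x : EuclideanSpace ℝ (Fin 3)} (hx : x ∈ CB) (k : Fin 3) :
    fderivWithin ℝ (energyFlux u₁ u₂ k) CB x (EuclideanSpace.single k 1) =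
      inner ℝ (pd u₂ x k) (pd u₁ x k) + inner ℝ (u₂ x) (pd (fun y => pd u₁ y k) x k)
        - (1 / 2) * ((∑ j, ‖pd u₁ x j‖ ^ 2) + ‖u₂ x‖ ^ 2)
        - x k * ((∑ j, inner ℝ (pd u₁ x j) (pd (fun y => pd u₁ y j) x k))
          + inner ℝ (u₂ x) (pd u₂ x k)) := by
  have hg : ∀ j, HasFDerivWithinAt (fun y => pd u₁ y j)
      (fderivWithin ℝ (fun y => pd u₁ y j) CB x) CB x := fun j =>
    ((hu₁.pd_CB (m := 1) (by norm_num) j).differentiableOn one_ne_zero x hx).hasFDerivWithinAt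
  have h2 : HasFDerivWithinAt u₂ (fderivWithin ℝ u₂ CB x) CB x :=
    (hu₂.differentiableOn one_ne_zero x hx).hasFDerivWithinAt
  have hxk : HasFDerivWithinAt (fun y : EuclideanSpace ℝ (Fin 3) => y k)
      (EuclideanSpace.proj k : EuclideanSpace ℝ (Fin 3) →L[ℝ] ℝ) CB x :=
    (EuclideanSpace.proj k : EuclideanSpace ℝ (Fin 3) →L[ℝ] ℝ).hasFDerivWithinAt
  have h := (h2.inner ℝ (hg k)).sub ((hxk.mul
    ((HasFDerivWithinAt.fun_sum (u := Finset.univ) fun j _ => (hg j).norm_sq).add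
      h2.norm_sq)).const_mul (1 / 2))
  have h' := h.fderivWithin (uniqueDiffOn_CB x hx)
  change fderivWithin ℝ (energyFlux u₁ u₂ k) CB x = _ at h'
  rw [h']
  simp only [pd]
  simp [fderivInnerCLM_apply, Fin.sum_univ_three]
  ring

theorem pd_generator_fst (hu₁ : ContDiffOn ℝ 2 u₁ CB) (hu₂ : ContDiffOn ℝ 1 u₂ CB)
    {x : EuclideanSpace ℝ (Fin 3)} (hx : x ∈ CB) (k : Fin 3) :
    pd (fun ξ => -(∑ j : Fin 3, (ξ j : ℂ) * pd u₁ ξ j) - u₁ ξ + u₂ ξ) x k =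
      -(∑ j : Fin 3, (x j : ℂ) * pd (fun y => pd u₁ y j) x k) - 2 * pd u₁ x k + pd u₂ x k := by
  have hg : ∀ j, HasFDerivWithinAt (fun y => pd u₁ y j)
      (fderivWithin ℝ (fun y => pd u₁ y j) CB x) CB x := fun j =>
    ((hu₁.pd_CB (m := 1) (by norm_num) j).differentiableOn one_ne_zero x hx).hasFDerivWithinAt
  have h1 : HasFDerivWithinAt u₁ (fderivWithin ℝ u₁ CB x) CB x :=
    (hu₁.differentiableOn two_ne_zero x hx).hasFDerivWithinAt
  have h2 : HasFDerivWithinAt u₂ (fderivWithin ℝ u₂ CB x) CB x :=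
    (hu₂.differentiableOn one_ne_zero x hx).hasFDerivWithinAt
  have hxj : ∀ j : Fin 3, HasFDerivWithinAt (fun y : EuclideanSpace ℝ (Fin 3) => (y j : ℂ))
      (Complex.ofRealCLM.comp (EuclideanSpace.proj j : EuclideanSpace ℝ (Fin 3) →L[ℝ] ℝ)) CB x :=
    fun j => (Complex.ofRealCLM.comp
      (EuclideanSpace.proj j : EuclideanSpace ℝ (Fin 3) →L[ℝ] ℝ)).hasFDerivWithinAt
  have h := (((HasFDerivWithinAt.fun_sum (u := Finset.univ)
    fun j _ => (hxj j).mul (hg j)).neg.sub h1).add h2).fderivWithin (uniqueDiffOn_CB x hx)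
  simp only [pd] at h ⊢
  erw [h]
  fin_cases k <;>
  · simp [Fin.sum_univ_three]
    ring

theorem energy_density_eq (hu₁ : ContDiffOn ℝ 2 u₁ CB) (hu₂ : ContDiffOn ℝ 1 u₂ CB)
    {f₁ f₂ : EuclideanSpace ℝ (Fin 3) → ℂ}
    (hf₁ : f₁ = fun ξ => -(∑ j : Fin 3, (ξ j : ℂ) * pd u₁ ξ j) - u₁ ξ + u₂ ξ)
    (hf₂ : f₂ = fun ξ => lapl u₁ ξ - (∑ j : Fin 3, (ξ j : ℂ) * pd u₂ ξ j) - 2 * u₂ ξ)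
    {x : EuclideanSpace ℝ (Fin 3)} (hx : x ∈ CB) :
    ((∑ k : Fin 3, pd f₁ x k * (starRingEnd ℂ) (pd u₁ x k)) +
        f₂ x * (starRingEnd ℂ) (u₂ x)).re =
      (∑ k, fderivWithin ℝ (energyFlux u₁ u₂ k) CB x (EuclideanSpace.single k 1))
        - (1 / 2) * ((∑ k, ‖pd u₁ x k‖ ^ 2) + ‖u₂ x‖ ^ 2) := by
  have hl : lapl u₁ x = ∑ k, pd (fun y => pd u₁ y k) x k := rfl
  subst hf₁ hf₂
  simp only [fderivWithin_energyFlux hu₁ hu₂ hx, pd_generator_fst hu₁ hu₂ hx, hl]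
  simp only [Fin.sum_univ_three]
  rw [pd_pd_comm hu₁ hx 0 1, pd_pd_comm hu₁ hx 0 2, pd_pd_comm hu₁ hx 1 2]
  simp only [Complex.inner, ← Complex.normSq_eq_norm_sq, Complex.normSq_apply]
  simp
  ring

theorem boundary_density_le (x : EuclideanSpace ℝ (Fin 3)) (hx : ‖x‖ = 1) :
    (∑ k, x k * energyFlux u₁ u₂ k x) + ((-(∑ j : Fin 3, (x j : ℂ) * pd u₁ x j) - u₁ x + u₂ x) *
      (starRingEnd ℂ) (u₁ x)).re ≤ -(1 / 2) * ‖u₁ x‖ ^ 2 := by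
  have hs : x 0 ^ 2 + x 1 ^ 2 + x 2 ^ 2 = 1 := by
    have := EuclideanSpace.real_norm_sq_eq x
    rw [hx, Fin.sum_univ_three] at this
    linarith
  simp only [energyFlux, Fin.sum_univ_three, Complex.inner, ← Complex.normSq_eq_norm_sq,
    Complex.normSq_apply]
  generalize x 0 = a at *
  generalize x 1 = b at *
  generalize x 2 = c at *
  generalize pd u₁ x 0 = p
  generalize pd u₁ x 1 = q
  generalize pd u₁ x 2 = r
  have cs : ∀ s t w : ℝ, (a * s + b * t + c * w) ^ 2 ≤ s ^ 2 + t ^ 2 + w ^ 2 := by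
    intro s t w
    have : s ^ 2 + t ^ 2 + w ^ 2 = (a ^ 2 + b ^ 2 + c ^ 2) * (s ^ 2 + t ^ 2 + w ^ 2) := by
      rw [hs, one_mul]
    nlinarith [sq_nonneg (a * t - b * s), sq_nonneg (a * w - c * s), sq_nonneg (b * w - c * t)]
  have h1 := cs p.re q.re r.re
  have h2 := cs p.im q.im r.im
  have h3 := sq_nonneg (a * p.re + b * q.re + c * r.re - (u₂ x).re + (u₁ x).re)
  have h4 := sq_nonneg (a * p.im + b * q.im + c * r.im - (u₂ x).im + (u₁ x).im)
  simp
  set S := p.re * p.re + p.im * p.im + (q.re * q.re + q.im * q.im) + (r.re * r.re + r.im * r.im) +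
    ((u₂ x).re * (u₂ x).re + (u₂ x).im * (u₂ x).im) with hS
  have h5 : a * (a * S) + b * (b * S) + c * (c * S) = S := by linear_combination S * hs
  nlinarith [h1, h2, h3, h4, h5]

end

theorem integrableOn_ball_of_continuousOn_CB {F : Type*} [NormedAddCommGroup F]
    {h : EuclideanSpace ℝ (Fin 3) → F} (hh : ContinuousOn h CB) :
    IntegrableOn h (ball 0 1) :=
  (hh.integrableOn_compact (isCompact_closedBall 0 1)).mono_set ball_subset_closedBall

theorem integrable_sphere_of_continuousOn_CB {F : Type*} [NormedAddCommGroup F]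
    {h : EuclideanSpace ℝ (Fin 3) → F} (hh : ContinuousOn h CB) :
    Integrable (fun ω : sphere (0 : EuclideanSpace ℝ (Fin 3)) 1 => h ω)
      (volume : Measure (EuclideanSpace ℝ (Fin 3))).toSphere :=
  (hh.comp_continuous continuous_subtype_val fun ω =>
    sphere_subset_closedBall ω.2).integrable_of_hasCompactSupport (.of_compactSpace _)

end

/-- Dissipativity of the free generator in similarity coordinates:
with `f₁ = -ξ^j∂_ju₁ - u₁ + u₂` and `f₂ = Δu₁ - ξ^j∂_ju₂ - 2u₂`,
`Re[(L̃₀u|u)] = Re[∫_B ∂_kf₁ conj(∂_ku₁) + ∫_{∂B} f₁ conj(u₁) dσ + ∫_B f₂ conj(u₂)]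
  ≤ -(1/2)[∫_B |∇u₁|² + ∫_{∂B} |u₁|² dσ + ∫_B |u₂|²]`. -/
theorem stmt9 (u₁ u₂ : EuclideanSpace ℝ (Fin 3) → ℂ)
    (hu₁ : ContDiffOn ℝ 2 u₁ CB) (hu₂ : ContDiffOn ℝ 1 u₂ CB)
    (f₁ f₂ : EuclideanSpace ℝ (Fin 3) → ℂ)
    (hf₁ : f₁ = fun ξ => -(∑ j : Fin 3, (ξ j : ℂ) * pd u₁ ξ j) - u₁ ξ + u₂ ξ)
    (hf₂ : f₂ = fun ξ => lapl u₁ ξ - (∑ j : Fin 3, (ξ j : ℂ) * pd u₂ ξ j) - 2 * u₂ ξ) :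
    ((∫ ξ in ball (0 : EuclideanSpace ℝ (Fin 3)) 1,
          ∑ k : Fin 3, pd f₁ ξ k * (starRingEnd ℂ) (pd u₁ ξ k)) +
        (∫ ω : sphere (0 : EuclideanSpace ℝ (Fin 3)) 1,
          f₁ ω * (starRingEnd ℂ) (u₁ ω) ∂(volume.toSphere)) +
        ∫ ξ in ball (0 : EuclideanSpace ℝ (Fin 3)) 1,
          f₂ ξ * (starRingEnd ℂ) (u₂ ξ)).re ≤
      -(1/2) * ((∫ ξ in ball (0 : EuclideanSpace ℝ (Fin 3)) 1,
            ∑ k : Fin 3, ‖pd u₁ ξ k‖ ^ 2) +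
          (∫ ω : sphere (0 : EuclideanSpace ℝ (Fin 3)) 1,
            ‖u₁ ω‖ ^ 2 ∂(volume.toSphere)) +
          ∫ ξ in ball (0 : EuclideanSpace ℝ (Fin 3)) 1, ‖u₂ ξ‖ ^ 2) := by
  have hg : ∀ k, ContDiffOn ℝ 1 (fun x => pd u₁ x k) CB := hu₁.pd_CB (by norm_num)
  have hgc : ∀ k, ContinuousOn (fun x => pd u₁ x k) CB := fun k => (hg k).continuousOn
  have hdu₂ : ∀ k, ContinuousOn (fun x => pd u₂ x k) CB := fun k =>
    (hu₂.pd_CB (m := 0) (by norm_num) k).continuousOn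
  have hcoord : ∀ k : Fin 3, ContDiff ℝ 1 fun y : EuclideanSpace ℝ (Fin 3) => (y k : ℂ) :=
    fun k => (Complex.ofRealCLM.comp
      (EuclideanSpace.proj k : EuclideanSpace ℝ (Fin 3) →L[ℝ] ℝ)).contDiff
  have hf₁d : ContDiffOn ℝ 1 f₁ CB := by
    rw [hf₁]
    exact ((ContDiffOn.sum fun k _ => (hcoord k).contDiffOn.mul (hg k)).neg.sub
      (hu₁.of_le (by norm_num))).add hu₂
  have hf₂c : ContinuousOn f₂ CB := by
    rw [hf₂]
    refine (ContinuousOn.sub ?_ (continuousOn_finsetSum _ fun k _ =>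
      (hcoord k).continuous.continuousOn.mul (hdu₂ k))).sub
      (continuousOn_const.mul hu₂.continuousOn)
    exact continuousOn_finsetSum _ fun k _ => ((hg k).pd_CB (m := 0) (by norm_num) k).continuousOn
  have hi₁ : IntegrableOn (fun ξ => ∑ k : Fin 3, pd f₁ ξ k * (starRingEnd ℂ) (pd u₁ ξ k))
      (ball 0 1) := integrableOn_ball_of_continuousOn_CB (continuousOn_finsetSum Finset.univ fun k _ =>
    ((hf₁d.pd_CB (m := 0) (by norm_num) k).continuousOn.mul
      (Complex.continuous_conj.comp_continuousOn (hgc k))))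
  have hi₂ : IntegrableOn (fun ξ => f₂ ξ * (starRingEnd ℂ) (u₂ ξ)) (ball 0 1) := integrableOn_ball_of_continuousOn_CB
    (hf₂c.mul (Complex.continuous_conj.comp_continuousOn hu₂.continuousOn))
  have hn₁ : IntegrableOn (fun ξ => ∑ k : Fin 3, ‖pd u₁ ξ k‖ ^ 2) (ball 0 1) := integrableOn_ball_of_continuousOn_CB (continuousOn_finsetSum Finset.univ fun k _ =>
    (hgc k).norm.pow 2)
  have hn₂ : IntegrableOn (fun ξ => ‖u₂ ξ‖ ^ 2) (ball 0 1) := integrableOn_ball_of_continuousOn_CB (hu₂.continuousOn.norm.pow 2)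
  have hV := contDiffOn_energyFlux hu₁ hu₂
  have hdV : ∀ k, IntegrableOn (fun x =>
      fderivWithin ℝ (energyFlux u₁ u₂ k) CB x (EuclideanSpace.single k 1)) (ball 0 1) := fun k =>
    integrableOn_ball_of_continuousOn_CB
      (((hV k).continuousOn_fderivWithin uniqueDiffOn_CB le_rfl).clm_apply continuousOn_const)
  have hsV : ∀ k : Fin 3, Integrable (fun ω : sphere (0 : EuclideanSpace ℝ (Fin 3)) 1 =>
      (ω : EuclideanSpace ℝ (Fin 3)) k * energyFlux u₁ u₂ k ω)
      (volume : Measure (EuclideanSpace ℝ (Fin 3))).toSphere := fun k =>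
    integrable_sphere_of_continuousOn_CB (h := fun x => x k * energyFlux u₁ u₂ k x)
      ((EuclideanSpace.proj k : EuclideanSpace ℝ (Fin 3) →L[ℝ] ℝ).continuous.continuousOn.mul
        (hV k).continuousOn)
  have hs₁ : Integrable (fun ω : sphere (0 : EuclideanSpace ℝ (Fin 3)) 1 =>
      f₁ ω * (starRingEnd ℂ) (u₁ ω)) (volume : Measure (EuclideanSpace ℝ (Fin 3))).toSphere :=
    integrable_sphere_of_continuousOn_CB
    (hf₁d.continuousOn.mul (Complex.continuous_conj.comp_continuousOn hu₁.continuousOn))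
  have hs₂ : Integrable (fun ω : sphere (0 : EuclideanSpace ℝ (Fin 3)) 1 => ‖u₁ ω‖ ^ 2)
      (volume : Measure (EuclideanSpace ℝ (Fin 3))).toSphere := integrable_sphere_of_continuousOn_CB (hu₁.continuousOn.norm.pow 2)
  have hbulk : ((∫ ξ in ball (0 : EuclideanSpace ℝ (Fin 3)) 1,
          ∑ k : Fin 3, pd f₁ ξ k * (starRingEnd ℂ) (pd u₁ ξ k)) +
        ∫ ξ in ball (0 : EuclideanSpace ℝ (Fin 3)) 1, f₂ ξ * (starRingEnd ℂ) (u₂ ξ)).re =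
      (∑ k, ∫ ω : sphere (0 : EuclideanSpace ℝ (Fin 3)) 1,
        (ω : EuclideanSpace ℝ (Fin 3)) k * energyFlux u₁ u₂ k ω ∂(volume.toSphere))
      - (1 / 2) * ((∫ ξ in ball (0 : EuclideanSpace ℝ (Fin 3)) 1, ∑ k : Fin 3, ‖pd u₁ ξ k‖ ^ 2) +
          ∫ ξ in ball (0 : EuclideanSpace ℝ (Fin 3)) 1, ‖u₂ ξ‖ ^ 2) := by
    calc
      _ = ∫ ξ in ball (0 : EuclideanSpace ℝ (Fin 3)) 1,
          ((∑ k : Fin 3, pd f₁ ξ k * (starRingEnd ℂ) (pd u₁ ξ k)) +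
            f₂ ξ * (starRingEnd ℂ) (u₂ ξ)).re := by
        rw [← integral_add hi₁ hi₂]
        exact (Complex.reCLM.integral_comp_comm (hi₁.add hi₂)).symm
      _ = ∫ ξ in ball (0 : EuclideanSpace ℝ (Fin 3)) 1,
          ((∑ k, fderivWithin ℝ (energyFlux u₁ u₂ k) CB ξ (EuclideanSpace.single k 1))
            - (1 / 2) * ((∑ k, ‖pd u₁ ξ k‖ ^ 2) + ‖u₂ ξ‖ ^ 2)) :=
        setIntegral_congr_fun measurableSet_ball fun x hx =>
          energy_density_eq hu₁ hu₂ hf₁ hf₂ (ball_subset_closedBall hx)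
      _ = _ := by
        have hn : IntegrableOn (fun ξ => (1 / 2) * ((∑ k : Fin 3, ‖pd u₁ ξ k‖ ^ 2) + ‖u₂ ξ‖ ^ 2))
            (ball 0 1) := (hn₁.add hn₂).const_mul _
        rw [integral_sub (integrable_finsetSum _ fun k _ => hdV k) hn,
          integral_const_mul, integral_add hn₁ hn₂, integral_finsetSum _ fun k _ => hdV k]
        congr 1
        refine Finset.sum_congr rfl fun k _ => ?_
        rw [integral_ball_fderivWithin volume (hV k)]
        simp [EuclideanSpace.inner_single_right]
  have hbdry : (∑ k, ∫ ω : sphere (0 : EuclideanSpace ℝ (Fin 3)) 1,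
        (ω : EuclideanSpace ℝ (Fin 3)) k * energyFlux u₁ u₂ k ω ∂(volume.toSphere)) +
      (∫ ω : sphere (0 : EuclideanSpace ℝ (Fin 3)) 1,
          f₁ ω * (starRingEnd ℂ) (u₁ ω) ∂(volume.toSphere)).re ≤
      -(1 / 2) * ∫ ω : sphere (0 : EuclideanSpace ℝ (Fin 3)) 1,
            ‖u₁ ω‖ ^ 2 ∂(volume.toSphere) := by
    have hre := Complex.reCLM.integral_comp_comm hs₁
    simp only [Complex.reCLM_apply] at hre
    erw [← integral_finsetSum _ fun k _ => hsV k, ← hre, ← integral_const_mul,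
      ← integral_add (integrable_finsetSum _ fun k _ => hsV k) (Complex.reCLM.integrable_comp hs₁)]
    refine integral_mono ((integrable_finsetSum _ fun k _ => hsV k).add
      (Complex.reCLM.integrable_comp hs₁)) (hs₂.const_mul _) fun ω => ?_
    subst hf₁
    exact boundary_density_le ω (mem_sphere_zero_iff_norm.1 ω.2)
  rw [Complex.add_re] at hbulk
  rw [Complex.add_re, Complex.add_re]
  linarith
end
end

section
/- Let λ ∈ ℂ with Re λ > −1/2, let ℓ ∈ ℕ₀, and let u : (0,1) → ℂ be a twice continuously differentiable solution of the spectral ODE −(1−ρ²)u''(ρ) − (2/ρ)u'(ρ) + 2(λ+2)ρ u'(ρ) + [(λ+1)(λ+2) − 6] u(ρ) + (ℓ(ℓ+1)/ρ²) u(ρ) = 0 on (0,1) satisfying the weighted integrability condition ∫_0^1 ( |u'(ρ)|² + |u(ρ)|² ) ρ² dρ < ∞. If u is not identically zero, then (ℓ,λ) = (0,1) or (ℓ,λ) = (1,0). In other words, the only spectral parameters λ with Re λ > −1/2 admitting a nontrivial H¹-type radial solution in some spherical-harmonic sector ℓ are λ = 1 (with ℓ = 0) and λ = 0 (with ℓ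 = 1). -/
open Set MeasureTheory

/-- Mean value inequality with a comparison function. -/
theorem norm_sub_le_of_norm_hasDerivAt_le {f f' : ℝ → ℂ} {B B' : ℝ → ℝ} {a b : ℝ} (hab : a ≤ b)
    (hf : ∀ x ∈ Icc a b, HasDerivAt f (f' x) x) (hB : ∀ x ∈ Icc a b, HasDerivAt B (B' x) x)
    (h : ∀ x ∈ Icc a b, ‖f' x‖ ≤ B' x) : ‖f b - f a‖ ≤ B b - B a := by
  have key := image_norm_le_of_norm_deriv_right_le_deriv_boundary' (f := fun x => f x - f a)
    (f' := f') (a := a) (b := b) (B := fun x => B x - B a) (B' := B')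
    (fun x hx => ((hf x hx).sub_const _).continuousAt.continuousWithinAt)
    (fun x hx => ((hf x (Ico_subset_Icc_self hx)).sub_const _).hasDerivWithinAt) (by simp)
    (fun x hx => ((hB x hx).sub_const _).continuousAt.continuousWithinAt)
    (fun x hx => ((hB x (Ico_subset_Icc_self hx)).sub_const _).hasDerivWithinAt)
    (fun x hx => h x (Ico_subset_Icc_self hx))
  exact key (right_mem_Icc.2 hab)

/-- `1 / (x - c)` does not lie below an integrable function next to `c`. -/
theorem exists_mem_abs_sub_mul_lt {N : ℝ → ℝ} {a b c ε : ℝ} (hab : a < b) (hε : 0 < ε)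
    (hc : c = a ∨ c = b) (hN : IntegrableOn N (Ioo a b)) :
    ∃ x ∈ Ioo a b, |x - c| * N x < ε := by
  by_contra! hcon
  have hne : ¬ IntervalIntegrable (fun x : ℝ => (x - c)⁻¹) volume a b := by
    rw [intervalIntegrable_sub_inv_iff]
    rintro (h | h)
    · exact hab.ne h
    · apply h
      rcases hc with rfl | rfl <;> simp
  apply hne
  rw [intervalIntegrable_iff_integrableOn_Ioo_of_le hab.le]
  refine Integrable.mono' (hN.const_mul ε⁻¹) (by fun_prop) ?_
  refine (ae_restrict_mem measurableSet_Ioo).mono fun x hx => ?_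
  have h1 := hcon x hx
  have h2 : 0 < |x - c| := by
    rcases hc with rfl | rfl
    · exact abs_pos.2 (sub_pos.2 hx.1).ne'
    · exact abs_pos.2 (sub_neg.2 hx.2).ne
  rw [norm_inv, Real.norm_eq_abs, inv_le_iff_one_le_mul₀ h2]
  field_simp
  linarith

/-- A function on `(0,1)` whose derivative is square integrable for the weight `ρ²` is `O(1/ρ)`. -/
theorem exists_norm_le_div_of_integrableOn {u u' : ℝ → ℂ} {N : ℝ → ℝ}
    (hu : ∀ x ∈ Ioo (0 : ℝ) 1, HasDerivAt u (u' x) x) (hu' : ContinuousOn u' (Ioo 0 1))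
    (hN : IntegrableOn N (Ioo 0 1)) (hN0 : ∀ x, 0 ≤ N x)
    (h : ∀ x ∈ Ioo (0 : ℝ) 1, ‖u' x‖ ^ 2 * x ^ 2 ≤ N x) :
    ∃ K : ℝ, 0 < K ∧ ∀ x ∈ Ioo (0 : ℝ) 1, ‖u x‖ ≤ K / x := by
  have main : ∀ a b : ℝ, 0 < a → a ≤ b → b < 1 →
      ‖u b - u a‖ ≤ (∫ x in Ioo 0 1, N x) + a⁻¹ := by
    intro a b ha hab hb
    have hsub : Icc a b ⊆ Ioo 0 1 := fun x hx => ⟨ha.trans_le hx.1, hx.2.trans_lt hb⟩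
    have hNi : IntervalIntegrable N volume a b := by
      rw [intervalIntegrable_iff_integrableOn_Icc_of_le hab]
      exact hN.mono_set hsub
    have hinv : ∀ x ∈ uIcc a b, HasDerivAt (fun x : ℝ => -x⁻¹) (x ^ 2)⁻¹ x := by
      intro x hx
      rw [uIcc_of_le hab] at hx
      have := (hasDerivAt_inv (hsub hx).1.ne').neg
      rw [neg_neg] at this
      exact this
    have hinvi : IntervalIntegrable (fun x : ℝ => (x ^ 2)⁻¹) volume a b := by
      apply ContinuousOn.intervalIntegrable
      rw [uIcc_of_le hab]
      exact ContinuousOn.inv₀ (by fun_prop) fun x hx => (pow_pos (hsub hx).1 2).ne'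
    have hu'i : IntervalIntegrable u' volume a b := by
      apply ContinuousOn.intervalIntegrable
      rw [uIcc_of_le hab]
      exact hu'.mono hsub
    rw [← intervalIntegral.integral_eq_sub_of_hasDerivAt
      (fun x hx => hu x (hsub (by rwa [uIcc_of_le hab] at hx))) hu'i]
    calc ‖∫ x in a..b, u' x‖ ≤ ∫ x in a..b, (N x + (x ^ 2)⁻¹) := by
          refine intervalIntegral.norm_integral_le_of_norm_le hab ?_ (hNi.add hinvi)
          refine Filter.Eventually.of_forall fun x hx => ?_
          have hx' := hsub (Ioc_subset_Icc_self hx)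
          have h1 := h x hx'
          have h2 : ‖u' x‖ = (‖u' x‖ * x) * x⁻¹ := by field_simp [hx'.1.ne']
          have h3 : (x ^ 2)⁻¹ = x⁻¹ ^ 2 := by simp
          rw [h3, h2]
          nlinarith [sq_nonneg (‖u' x‖ * x - x⁻¹), sq_nonneg (‖u' x‖ * x), sq_nonneg x⁻¹]
      _ = (∫ x in a..b, N x) + (a⁻¹ - b⁻¹) := by
          rw [intervalIntegral.integral_add hNi hinvi,
            intervalIntegral.integral_eq_sub_of_hasDerivAt hinv hinvi]
          ring
      _ ≤ _ := by
          have : 0 < b⁻¹ := inv_pos.2 (ha.trans_le hab)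
          have h4 : (∫ x in a..b, N x) ≤ ∫ x in Ioo 0 1, N x := by
            rw [intervalIntegral.integral_of_le hab]
            exact setIntegral_mono_set hN (Filter.Eventually.of_forall hN0)
              (Filter.Eventually.of_forall (Ioc_subset_Icc_self.trans hsub))
          linarith
  have hI : 0 ≤ ∫ x in Ioo 0 1, N x := integral_nonneg hN0
  set I := ∫ x in Ioo 0 1, N x
  refine ⟨‖u (1 / 2)‖ + I + 2, by positivity, fun x hx => ?_⟩
  have hx1 : 1 ≤ x⁻¹ := (one_le_inv₀ hx.1).2 hx.2.le
  have key : ‖u x - u (1 / 2)‖ ≤ I + 2 * x⁻¹ := by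
    rcases le_total x (1 / 2) with h2 | h2
    · have := main x (1 / 2) hx.1 h2 (by norm_num)
      rw [norm_sub_rev]
      linarith
    · have := main (1 / 2) x (by norm_num) h2 hx.2
      norm_num at this ⊢
      linarith
  have h5 : ‖u x‖ ≤ ‖u (1 / 2)‖ + ‖u x - u (1 / 2)‖ := by
    have := norm_add_le (u (1 / 2)) (u x - u (1 / 2))
    simpa using this
  rw [div_eq_mul_inv]
  nlinarith [norm_nonneg (u (1 / 2))]

section FirstOrderSystem

/-! For `w = u' - (ℓ / ρ) u` and `σ = λ + 1`, the spectral equation is the first-order system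
`u' = w + (ℓ / ρ) u`, `(1 - ρ²) w' = (2 σ ρ - (ℓ + 2) (1 - ρ²) / ρ) w + κ u` with
`κ = (σ + ℓ + 3) (σ + ℓ - 2)`. -/

theorem re_mul_conj_add_mul_conj (σ A G : ℂ) (x s q m : ℝ) :
    (σ * ((A + σ * x * G) / s) * (starRingEnd ℂ) A
      + σ * G * (starRingEnd ℂ) ((σ * x * A - q * A + (σ ^ 2 + m) * G) / s)).re
    = (σ.re * (Complex.normSq A + (Complex.normSq σ + m) * Complex.normSq G)
      + (2 * σ.re * x - q) * (σ * G * (starRingEnd ℂ) A).re) / s := by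
  simp only [pow_two, Complex.normSq_apply, Complex.add_re, Complex.mul_re, Complex.mul_im,
    Complex.add_im, Complex.sub_re, Complex.sub_im, Complex.conj_re, Complex.conj_im,
    Complex.div_ofReal_re, Complex.div_ofReal_im, Complex.ofReal_re, Complex.ofReal_im]
  ring

variable {σ κ : ℂ} {ℓ : ℕ} {u w : ℝ → ℂ}

theorem one_sub_sq_pos_of_mem_Ioo {x : ℝ} (hx : x ∈ Ioo (0 : ℝ) 1) : 0 < 1 - x ^ 2 := by
  nlinarith [hx.1, hx.2]

theorem hasDerivAt_one_sub_sq_rpow {r x : ℝ} (hx : x ∈ Ioo (0 : ℝ) 1) :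
    HasDerivAt (fun y : ℝ => (1 - y ^ 2) ^ r) (-(2 * r * x * (1 - x ^ 2) ^ r / (1 - x ^ 2))) x := by
  have hp := one_sub_sq_pos_of_mem_Ioo hx
  have h1 : HasDerivAt (fun y : ℝ => 1 - y ^ 2) (-(2 * x)) x := by
    simpa using (hasDerivAt_pow 2 x).const_sub 1
  refine (h1.rpow_const (p := r) (Or.inl hp.ne')).congr_deriv ?_
  rw [Real.rpow_sub_one hp.ne']
  ring

theorem hasDerivAt_exp_mul_log_one_sub_sq {x : ℝ} (hx : x ∈ Ioo (0 : ℝ) 1) :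
    HasDerivAt (fun y : ℝ => Complex.exp (σ * (Real.log (1 - y ^ 2) : ℝ)))
      (-(2 * σ * x / (1 - x ^ 2)) * Complex.exp (σ * (Real.log (1 - x ^ 2) : ℝ))) x := by
  have hp := one_sub_sq_pos_of_mem_Ioo hx
  have h1 : HasDerivAt (fun y : ℝ => 1 - y ^ 2) (-(2 * x)) x := by
    simpa using (hasDerivAt_pow 2 x).const_sub 1
  refine ((h1.log hp.ne').ofReal_comp.const_mul σ).cexp.congr_deriv ?_
  push_cast
  ring

theorem norm_exp_mul_log_one_sub_sq {x : ℝ} (hx : x ∈ Ioo (0 : ℝ) 1) :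
    ‖Complex.exp (σ * (Real.log (1 - x ^ 2) : ℝ))‖ = (1 - x ^ 2) ^ σ.re := by
  rw [Complex.norm_exp, Real.rpow_def_of_pos (one_sub_sq_pos_of_mem_Ioo hx)]
  congr 1
  rw [Complex.re_mul_ofReal, mul_comm]

/-- If a solution `(u, w)` of the first-order system has finite energy, then `w` is bounded. -/
theorem exists_norm_le_of_system (hσ : 1 / 2 < σ.re)
    (hu : ∀ x ∈ Ioo (0 : ℝ) 1, HasDerivAt u (w x + ℓ / x * u x) x)
    (hw : ∀ x ∈ Ioo (0 : ℝ) 1, HasDerivAt w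
      (((2 * σ * x - (ℓ + 2) * (1 - x ^ 2) / x) * w x + κ * u x) / (1 - x ^ 2)) x)
    (hN : IntegrableOn (fun x : ℝ => (‖w x + ℓ / x * u x‖ ^ 2 + ‖u x‖ ^ 2) * x ^ 2) (Ioo 0 1)) :
    ∃ K : ℝ, 0 < K ∧ ∀ x ∈ Ioo (0 : ℝ) 1, ‖u x‖ ≤ K / x ∧ ‖w x‖ ≤ K := by
  set N : ℝ → ℝ := fun x => (‖w x + ℓ / x * u x‖ ^ 2 + ‖u x‖ ^ 2) * x ^ 2 with hNdef
  have hN0 : ∀ x, 0 ≤ N x := fun x => by positivity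
  obtain ⟨K, hK, huK⟩ : ∃ K : ℝ, 0 < K ∧ ∀ x ∈ Ioo (0 : ℝ) 1, ‖u x‖ ≤ K / x := by
    refine exists_norm_le_div_of_integrableOn hu (fun x hx => ?_) hN hN0 fun x _ => ?_
    · have hx0 : (x : ℂ) ≠ 0 := by exact_mod_cast hx.1.ne'
      refine ContinuousAt.continuousWithinAt ?_
      exact (hw x hx).continuousAt.add
        ((continuousAt_const.div Complex.continuous_ofReal.continuousAt hx0).mul
          (hu x hx).continuousAt)
    · simp only [hNdef]
      nlinarith [mul_nonneg (sq_nonneg ‖u x‖) (sq_nonneg x)]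
  -- `R` is the norm of `(1 - x²) ^ σ`, and the derivative of `H = x ^ (ℓ + 2) (1 - x²) ^ σ w`
  -- is `O(x ^ (ℓ + 1) R / (1 - x²))`
  set R : ℝ → ℝ := fun x => (1 - x ^ 2) ^ σ.re with hRdef
  have hR0 : ∀ x ∈ Ioo (0 : ℝ) 1, 0 < R x := fun x hx =>
    Real.rpow_pos_of_pos (one_sub_sq_pos_of_mem_Ioo hx) _
  have hR1 : ∀ x ∈ Ioo (0 : ℝ) 1, R x ≤ 1 := fun x hx =>
    Real.rpow_le_one (one_sub_sq_pos_of_mem_Ioo hx).le (by nlinarith [hx.1]) (by linarith)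
  have hR2 : ∀ x ∈ Ioo (0 : ℝ) 1, R x ^ 2 ≤ 1 - x ^ 2 := fun x hx => by
    have hp := one_sub_sq_pos_of_mem_Ioo hx
    calc R x ^ 2 = (1 - x ^ 2) ^ (σ.re * 2) := by
          rw [Real.rpow_mul hp.le]; norm_cast
      _ ≤ (1 - x ^ 2) ^ (1 : ℝ) :=
          Real.rpow_le_rpow_of_exponent_ge hp (by nlinarith [hx.1]) (by linarith)
      _ = 1 - x ^ 2 := Real.rpow_one _
  set H : ℝ → ℂ := fun x =>
    (x : ℂ) ^ (ℓ + 2) * Complex.exp (σ * (Real.log (1 - x ^ 2) : ℝ)) * w x with hHdef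
  set H' : ℝ → ℂ := fun x =>
    κ * (x : ℂ) ^ (ℓ + 2) * Complex.exp (σ * (Real.log (1 - x ^ 2) : ℝ)) * u x / (1 - x ^ 2)
    with hHdef'
  have hHn : ∀ x ∈ Ioo (0 : ℝ) 1, ‖H x‖ = x ^ (ℓ + 2) * R x * ‖w x‖ := fun x hx => by
    rw [hHdef]
    simp only [norm_mul, norm_exp_mul_log_one_sub_sq hx, norm_pow, Complex.norm_real,
      Real.norm_of_nonneg hx.1.le, hRdef]
  have hHd : ∀ x ∈ Ioo (0 : ℝ) 1, HasDerivAt H (H' x) x := fun x hx => by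
    have hx0 : (x : ℂ) ≠ 0 := by exact_mod_cast hx.1.ne'
    have hp : (1 : ℂ) - (x : ℂ) ^ 2 ≠ 0 := by exact_mod_cast (one_sub_sq_pos_of_mem_Ioo hx).ne'
    have h1 : HasDerivAt (fun y : ℝ => (y : ℂ) ^ (ℓ + 2)) ((ℓ + 2) * (x : ℂ) ^ (ℓ + 1)) x := by
      have := (hasDerivAt_pow (ℓ + 2) (x : ℂ)).comp_ofReal
      simpa using this
    refine ((h1.mul (hasDerivAt_exp_mul_log_one_sub_sq (σ := σ) hx)).mul (hw x hx)).congr_deriv ?_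
    simp only [hHdef', Pi.mul_apply]
    field_simp
    ring
  have hHn' : ∀ x ∈ Ioo (0 : ℝ) 1, ‖H' x‖ ≤ ‖κ‖ * K * x ^ (ℓ + 1) * (R x / (1 - x ^ 2)) := by
    intro x hx
    have hp := one_sub_sq_pos_of_mem_Ioo hx
    have h1 : ‖(1 : ℂ) - (x : ℂ) ^ 2‖ = 1 - x ^ 2 := by
      rw [← Real.norm_of_nonneg hp.le, ← Complex.norm_real]; norm_cast
    rw [hHdef']
    simp only [norm_mul, norm_div, norm_exp_mul_log_one_sub_sq hx, norm_pow, Complex.norm_real,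
      Real.norm_of_nonneg hx.1.le, h1]
    have h2 : x * ‖u x‖ ≤ K := by
      have := huK x hx
      rwa [le_div_iff₀ hx.1, mul_comm] at this
    calc ‖κ‖ * x ^ (ℓ + 2) * (1 - x ^ 2) ^ σ.re * ‖u x‖ / (1 - x ^ 2)
        = ‖κ‖ * (x * ‖u x‖) * x ^ (ℓ + 1) * (R x / (1 - x ^ 2)) := by rw [hRdef]; ring
      _ ≤ _ := by
        have := hR0 x hx
        have := hx.1
        gcongr
  have hHN : ∀ x ∈ Ioo (0 : ℝ) 1, ‖H x‖ ^ 2 ≤ 2 * (1 + ℓ ^ 2) * (x * (1 - x ^ 2) * N x) := by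
    intro x hx
    have hx0 := hx.1
    have h1 : x ^ (ℓ + 2) * ‖w x‖ ≤ x ^ 2 * (‖w x + ℓ / x * u x‖ + ℓ * ‖u x‖) := by
      have h2 : ‖w x‖ ≤ ‖w x + ℓ / x * u x‖ + ℓ / x * ‖u x‖ := by
        have := norm_sub_le (w x + ℓ / x * u x) (ℓ / x * u x)
        simpa [Real.norm_of_nonneg hx.1.le, abs_of_pos hx.1] using this
      have h3 : (ℓ : ℝ) * x ^ (ℓ + 1) ≤ ℓ * x ^ 2 := by
        rcases Nat.eq_zero_or_pos ℓ with rfl | h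
        · simp
        · have := pow_le_pow_of_le_one hx.1.le hx.2.le (show 2 ≤ ℓ + 1 by omega)
          gcongr
      have h4 : x ^ (ℓ + 2) ≤ x ^ 2 := pow_le_pow_of_le_one hx.1.le hx.2.le (by omega)
      calc x ^ (ℓ + 2) * ‖w x‖ ≤ x ^ (ℓ + 2) * (‖w x + ℓ / x * u x‖ + ℓ / x * ‖u x‖) := by gcongr
        _ = x ^ (ℓ + 2) * ‖w x + ℓ / x * u x‖ + (ℓ * x ^ (ℓ + 1)) * ‖u x‖ := by
          field_simp
          ring
        _ ≤ x ^ 2 * ‖w x + ℓ / x * u x‖ + (ℓ * x ^ 2) * ‖u x‖ := by gcongr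
        _ = _ := by ring
    have h5 : (‖w x + ℓ / x * u x‖ + ℓ * ‖u x‖) ^ 2 ≤
        2 * (1 + ℓ ^ 2) * (‖w x + ℓ / x * u x‖ ^ 2 + ‖u x‖ ^ 2) := by
      have : (0 : ℝ) ≤ ℓ := Nat.cast_nonneg _
      nlinarith [sq_nonneg (‖w x + ℓ / x * u x‖ - ℓ * ‖u x‖), sq_nonneg ‖u x‖,
        mul_nonneg (sq_nonneg (ℓ : ℝ)) (sq_nonneg ‖w x + ℓ / x * u x‖)]
    calc ‖H x‖ ^ 2 = R x ^ 2 * (x ^ (ℓ + 2) * ‖w x‖) ^ 2 := by rw [hHn x hx]; ring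
      _ ≤ (1 - x ^ 2) * (x ^ 2 * (‖w x + ℓ / x * u x‖ + ℓ * ‖u x‖)) ^ 2 := by
        have := one_sub_sq_pos_of_mem_Ioo hx
        gcongr
        exact hR2 x hx
      _ = (1 - x ^ 2) * x ^ 4 * (‖w x + ℓ / x * u x‖ + ℓ * ‖u x‖) ^ 2 := by ring
      _ ≤ (1 - x ^ 2) * x ^ 3 * (2 * (1 + ℓ ^ 2) * (‖w x + ℓ / x * u x‖ ^ 2 + ‖u x‖ ^ 2)) := by
        have := one_sub_sq_pos_of_mem_Ioo hx
        have h6 := pow_le_pow_of_le_one hx.1.le hx.2.le (show 3 ≤ 4 by norm_num)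
        gcongr
      _ = _ := by simp only [hNdef]; ring
  have hsmall : ∀ ε > 0, ∀ a b c : ℝ, 0 ≤ a → a < b → b ≤ 1 → (c = a ∨ c = b) → (c = 0 ∨ c = 1) →
      ∃ x ∈ Ioo a b, ‖H x‖ < ε := by
    intro ε hε a b c ha hab hb hc hc'
    obtain ⟨x, hx, hxN⟩ := exists_mem_abs_sub_mul_lt (ε := ε ^ 2 / (4 * (1 + ℓ ^ 2))) hab
      (by positivity) hc (hN.mono_set (Ioo_subset_Ioo ha hb))
    refine ⟨x, hx, ?_⟩
    have hx' : x ∈ Ioo (0 : ℝ) 1 := Ioo_subset_Ioo ha hb hx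
    have h1 : x * (1 - x ^ 2) ≤ 2 * |x - c| := by
      rcases hc' with rfl | rfl
      · rw [sub_zero, abs_of_pos hx'.1]
        nlinarith [pow_pos hx'.1 3, hx'.1]
      · rw [abs_sub_comm, abs_of_pos (sub_pos.2 hx'.2)]
        nlinarith [mul_pos hx'.1 (sub_pos.2 hx'.2), hx'.1, hx'.2,
          mul_pos (mul_pos hx'.1 (sub_pos.2 hx'.2)) (sub_pos.2 hx'.2)]
    rw [lt_div_iff₀ (by positivity)] at hxN
    refine lt_of_pow_lt_pow_left₀ 2 hε.le ((hHN x hx').trans_lt ?_)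
    have h2 : x * (1 - x ^ 2) * N x ≤ 2 * |x - c| * N x := by
      gcongr
    calc _ ≤ 2 * (1 + (ℓ : ℝ) ^ 2) * (2 * |x - c| * N x) := by gcongr
      _ = |x - c| * N x * (4 * (1 + ℓ ^ 2)) := by ring
      _ < _ := hxN
  have hr : 0 < σ.re := by linarith
  have hB0 : ∀ x ∈ Ioc (0 : ℝ) (1 / 2), ‖H x‖ ≤ 2 * ‖κ‖ * K * x ^ (ℓ + 2) := by
    intro x hx
    refine le_of_forall_pos_le_add fun ε hε => ?_
    obtain ⟨a, ha, haH⟩ := hsmall ε hε 0 x 0 le_rfl hx.1 (by linarith [hx.2]) (Or.inl rfl)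
      (Or.inl rfl)
    have hmem : ∀ y ∈ Icc a x, y ∈ Ioo (0 : ℝ) 1 := fun y hy =>
      ⟨ha.1.trans_le hy.1, by linarith [hy.2, hx.2]⟩
    have h1 := norm_sub_le_of_norm_hasDerivAt_le (B := fun y => 2 * ‖κ‖ * K * y ^ (ℓ + 2))
      (B' := fun y => 2 * ‖κ‖ * K * ((ℓ + 2) * y ^ (ℓ + 1))) ha.2.le
      (fun y hy => hHd y (hmem y hy))
      (fun y hy => by
        simpa using (hasDerivAt_pow (ℓ + 2) y).const_mul (2 * ‖κ‖ * K)) fun y hy => by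
        refine (hHn' y (hmem y hy)).trans ?_
        have hy0 := (hmem y hy).1
        have hp := one_sub_sq_pos_of_mem_Ioo (hmem y hy)
        have h2 : R y / (1 - y ^ 2) ≤ 2 * (ℓ + 2) := by
          rw [div_le_iff₀ hp]
          have h3 : (3 : ℝ) / 4 ≤ 1 - y ^ 2 := by nlinarith [hy.2, hx.2]
          have : (0 : ℝ) ≤ ℓ := Nat.cast_nonneg _
          nlinarith [hR1 y (hmem y hy), mul_nonneg this hp.le]
        calc ‖κ‖ * K * y ^ (ℓ + 1) * (R y / (1 - y ^ 2))
            ≤ ‖κ‖ * K * y ^ (ℓ + 1) * (2 * (ℓ + 2)) := by gcongr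
          _ = _ := by ring
    have h4 : ‖H x‖ ≤ ‖H a‖ + ‖H x - H a‖ := by
      simpa using norm_add_le (H a) (H x - H a)
    have h5 : 0 ≤ 2 * ‖κ‖ * K * a ^ (ℓ + 2) := by
      have := ha.1
      positivity
    linarith
  have hB1 : ∀ x ∈ Ioo (0 : ℝ) 1, ‖H x‖ ≤ ‖κ‖ * K / σ.re * R x := by
    intro x hx
    refine le_of_forall_pos_le_add fun ε hε => ?_
    obtain ⟨b, hb, hbH⟩ := hsmall ε hε x 1 1 hx.1.le hx.2 le_rfl (Or.inr rfl)
      (Or.inr rfl)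
    have hmem : ∀ y ∈ Icc x b, y ∈ Ioo (0 : ℝ) 1 := fun y hy =>
      ⟨hx.1.trans_le hy.1, hy.2.trans_lt hb.2⟩
    have h1 := norm_sub_le_of_norm_hasDerivAt_le (B := fun y => -(‖κ‖ * K / σ.re) * R y)
      (B' := fun y => -(‖κ‖ * K / σ.re) * (-(2 * σ.re * y * R y / (1 - y ^ 2)))) hb.1.le
      (fun y hy => hHd y (hmem y hy))
      (fun y hy => (hasDerivAt_one_sub_sq_rpow (hmem y hy)).const_mul _) fun y hy => by
        refine (hHn' y (hmem y hy)).trans ?_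
        have hy0 := (hmem y hy).1
        have hp := one_sub_sq_pos_of_mem_Ioo (hmem y hy)
        have hRy := hR0 y (hmem y hy)
        have h2 : y ^ (ℓ + 1) ≤ 2 * y := by
          have := pow_le_pow_of_le_one hy0.le (hmem y hy).2.le (show 1 ≤ ℓ + 1 by omega)
          linarith
        calc ‖κ‖ * K * y ^ (ℓ + 1) * (R y / (1 - y ^ 2))
            ≤ ‖κ‖ * K * (2 * y) * (R y / (1 - y ^ 2)) := by gcongr
          _ = _ := by field_simp
    have h4 : ‖H x‖ ≤ ‖H b‖ + ‖H b - H x‖ := by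
      simpa using norm_sub_le (H b) (H b - H x)
    have h5 : 0 ≤ ‖κ‖ * K / σ.re * R b := by
      have := hR0 b (hmem b (right_mem_Icc.2 hb.1.le))
      positivity
    linarith
  refine ⟨K + 2 * ‖κ‖ * K / (3 / 4) ^ σ.re + ‖κ‖ * K / σ.re * 2 ^ (ℓ + 2), by positivity,
    fun x hx => ⟨(huK x hx).trans ?_, ?_⟩⟩
  · have := hx.1
    gcongr
    have : 0 ≤ 2 * ‖κ‖ * K / (3 / 4) ^ σ.re := by positivity
    have : 0 ≤ ‖κ‖ * K / σ.re * 2 ^ (ℓ + 2) := by positivity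
    linarith
  · have hx0 := hx.1
    have hRx := hR0 x hx
    have hA : 0 ≤ 2 * ‖κ‖ * K / (3 / 4) ^ σ.re := by positivity
    have hB : 0 ≤ ‖κ‖ * K / σ.re * 2 ^ (ℓ + 2) := by positivity
    rcases le_total x (1 / 2) with h | h
    · have h1 := hB0 x ⟨hx.1, h⟩
      rw [hHn x hx] at h1
      have h2 : (3 / 4 : ℝ) ^ σ.re ≤ R x :=
        Real.rpow_le_rpow (by norm_num) (by nlinarith) hr.le
      have h3 : R x * ‖w x‖ ≤ 2 * ‖κ‖ * K := by
        refine le_of_mul_le_mul_left ?_ (pow_pos hx0 (ℓ + 2))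
        linarith
      have h4 : ‖w x‖ ≤ 2 * ‖κ‖ * K / (3 / 4) ^ σ.re := by
        rw [le_div_iff₀ (by positivity), mul_comm]
        refine le_trans ?_ h3
        gcongr
      linarith
    · have h1 := hB1 x hx
      rw [hHn x hx] at h1
      have h2 : (1 / 2 : ℝ) ^ (ℓ + 2) ≤ x ^ (ℓ + 2) := by gcongr
      have h3 : x ^ (ℓ + 2) * ‖w x‖ ≤ ‖κ‖ * K / σ.re := by
        refine le_of_mul_le_mul_left ?_ hRx
        linarith
      have h4 : ‖w x‖ ≤ ‖κ‖ * K / σ.re * 2 ^ (ℓ + 2) := by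
        rw [← div_le_iff₀ (by positivity)]
        refine le_trans ?_ h3
        calc ‖w x‖ / 2 ^ (ℓ + 2) = (1 / 2) ^ (ℓ + 2) * ‖w x‖ := by
              rw [one_div, inv_pow, div_eq_inv_mul]
          _ ≤ _ := by gcongr
      linarith

/-- A solution of the first-order system with bounded `w` and `u = O(1/ρ)` has `w = 0`. -/
theorem eq_zero_of_system (hσ : 0 < σ.re) {K : ℝ} (hκ : κ = (σ + ℓ + 3) * (σ + ℓ - 2))
    (hu : ∀ x ∈ Ioo (0 : ℝ) 1, HasDerivAt u (w x + ℓ / x * u x) x)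
    (hw : ∀ x ∈ Ioo (0 : ℝ) 1, HasDerivAt w
      (((2 * σ * x - (ℓ + 2) * (1 - x ^ 2) / x) * w x + κ * u x) / (1 - x ^ 2)) x)
    (hK : ∀ x ∈ Ioo (0 : ℝ) 1, ‖u x‖ ≤ K / x ∧ ‖w x‖ ≤ K) :
    ∀ x ∈ Ioo (0 : ℝ) 1, w x = 0 := by
  have hne : ∀ x ∈ Ioo (0 : ℝ) 1, (x : ℂ) ≠ 0 ∧ (1 : ℂ) - (x : ℂ) ^ 2 ≠ 0 := fun x hx =>
    ⟨by exact_mod_cast hx.1.ne', by exact_mod_cast (one_sub_sq_pos_of_mem_Ioo hx).ne'⟩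
  set g : ℝ → ℂ := fun x => w x / x with hgdef
  set X : ℝ → ℂ := fun x => (σ - (ℓ + 3) * (1 - x ^ 2) / x ^ 2) * w x + κ * u x / x with hXdef
  have hg : ∀ x ∈ Ioo (0 : ℝ) 1, HasDerivAt g ((X x + σ * x * g x) / (1 - x ^ 2)) x := by
    intro x hx
    obtain ⟨hx0, hp⟩ := hne x hx
    have hid : HasDerivAt (fun y : ℝ => (y : ℂ)) 1 x := (hasDerivAt_id x).ofReal_comp
    refine ((hw x hx).div hid hx0).congr_deriv ?_
    simp only [hXdef, hgdef]
    field_simp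
    ring
  have hX : ∀ x ∈ Ioo (0 : ℝ) 1, HasDerivAt X ((σ * x * X x - 4 * (1 - x ^ 2) / x * X x
      + (σ ^ 2 + ℓ * (ℓ + 3) * (1 - x ^ 2) / x ^ 2) * g x) / (1 - x ^ 2)) x := by
    intro x hx
    obtain ⟨hx0, hp⟩ := hne x hx
    have hid : HasDerivAt (fun y : ℝ => (y : ℂ)) 1 x := (hasDerivAt_id x).ofReal_comp
    have hsq : HasDerivAt (fun y : ℝ => (y : ℂ) ^ 2) (2 * x) x := by
      simpa using (hasDerivAt_pow 2 (x : ℂ)).comp_ofReal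
    have h1 : HasDerivAt (fun y : ℝ => σ - (ℓ + 3) * (1 - (y : ℂ) ^ 2) / (y : ℂ) ^ 2)
        ((2 * (ℓ + 3)) / (x : ℂ) ^ 3) x := by
      refine ((((hsq.const_sub 1).const_mul ((ℓ : ℂ) + 3)).div hsq
        (pow_ne_zero 2 hx0)).const_sub σ).congr_deriv ?_
      field_simp
      ring
    refine ((h1.mul (hw x hx)).add (((hu x hx).const_mul κ).div hid hx0)).congr_deriv ?_
    simp only [hXdef, hgdef, hκ]
    field_simp
    ring
  set R : ℝ → ℝ := fun x => (1 - x ^ 2) ^ σ.re with hRdef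
  have hR0 : ∀ x ∈ Ioo (0 : ℝ) 1, 0 < R x := fun x hx =>
    Real.rpow_pos_of_pos (one_sub_sq_pos_of_mem_Ioo hx) _
  -- `Q` is a flux for the ground state representation of the Pöschl-Teller operator; it is monotone
  set Q : ℝ → ℝ := fun x => x ^ 4 * R x * (σ * g x * (starRingEnd ℂ) (X x)).re with hQdef
  set Q' : ℝ → ℝ := fun x => x ^ 4 * (R x / (1 - x ^ 2)) * σ.re * (Complex.normSq (X x)
    + (Complex.normSq σ + ℓ * (ℓ + 3) * (1 - x ^ 2) / x ^ 2) * Complex.normSq (g x)) with hQdef'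
  have hQ : ∀ x ∈ Ioo (0 : ℝ) 1, HasDerivAt Q (Q' x) x := by
    intro x hx
    have hx0 := hx.1.ne'
    have hp := (one_sub_sq_pos_of_mem_Ioo hx).ne'
    have h1 := ((hg x hx).const_mul σ).mul (hX x hx).star
    have h2 : HasDerivAt (fun y => (σ * g y * (starRingEnd ℂ) (X y)).re) _ x :=
      Complex.reCLM.hasFDerivAt.comp_hasDerivAt x h1
    refine (((hasDerivAt_pow 4 x).mul (hasDerivAt_one_sub_sq_rpow (r := σ.re) hx)).mul
      h2).congr_deriv ?_
    have h3 := re_mul_conj_add_mul_conj σ (X x) (g x) x (1 - x ^ 2) (4 * (1 - x ^ 2) / x)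
      (ℓ * (ℓ + 3) * (1 - x ^ 2) / x ^ 2)
    push_cast at h3
    simp only [Complex.reCLM_apply, Complex.star_def, h3, Pi.mul_apply, hQdef', hRdef]
    field_simp
    ring
  have hQ'0 : ∀ x ∈ Ioo (0 : ℝ) 1, 0 ≤ Q' x := by
    intro x hx
    have := hx.1
    have := one_sub_sq_pos_of_mem_Ioo hx
    have := hR0 x hx
    simp only [hQdef']
    have := Complex.normSq_nonneg (X x)
    have := Complex.normSq_nonneg (g x)
    have := Complex.normSq_nonneg σ
    positivity
  have hmono : MonotoneOn Q (Ioo 0 1) := by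
    refine monotoneOn_of_deriv_nonneg (convex_Ioo 0 1)
      (fun x hx => (hQ x hx).continuousAt.continuousWithinAt) ?_ ?_
    · rw [interior_Ioo]
      exact fun x hx => (hQ x hx).differentiableAt.differentiableWithinAt
    · rw [interior_Ioo]
      exact fun x hx => (hQ x hx).deriv ▸ hQ'0 x hx
  obtain ⟨M, hM⟩ : ∃ M : ℝ, ∀ x ∈ Ioo (0 : ℝ) 1, |Q x| ≤ M * (x * R x) := by
    refine ⟨‖σ‖ * K * ((‖σ‖ + (ℓ + 3)) * K + ‖κ‖ * K), fun x hx => ?_⟩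
    have hx0 := hx.1
    have hp := one_sub_sq_pos_of_mem_Ioo hx
    have hRx := hR0 x hx
    obtain ⟨huK, hwK⟩ := hK x hx
    have hK0 : 0 ≤ K := (norm_nonneg _).trans hwK
    have h1 : ‖(1 : ℂ) - (x : ℂ) ^ 2‖ = 1 - x ^ 2 := by
      rw [← Real.norm_of_nonneg hp.le, ← Complex.norm_real]; norm_cast
    have hg' : x * ‖g x‖ ≤ K := by
      simp only [hgdef, norm_div, Complex.norm_real, Real.norm_of_nonneg hx0.le]
      rwa [mul_div_cancel₀ _ hx0.ne']
    have hX' : x ^ 2 * ‖X x‖ ≤ (‖σ‖ + (ℓ + 3)) * K + ‖κ‖ * K := by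
      have h2 : ‖X x‖ ≤ (‖σ‖ + (ℓ + 3) * (1 - x ^ 2) / x ^ 2) * ‖w x‖ + ‖κ‖ * ‖u x‖ / x := by
        refine (norm_add_le _ _).trans ?_
        simp only [norm_mul, norm_div, Complex.norm_real, Real.norm_of_nonneg hx0.le]
        gcongr
        refine (norm_sub_le _ _).trans ?_
        have h3 : ‖(ℓ : ℂ) + 3‖ = ℓ + 3 := by exact_mod_cast Complex.norm_natCast (ℓ + 3)
        simp only [norm_mul, norm_div, norm_pow, Complex.norm_real, Real.norm_of_nonneg hx0.le, h1,
          h3, le_refl]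
      have h4 : x * ‖u x‖ ≤ K := by rwa [le_div_iff₀ hx0, mul_comm] at huK
      have h5 : x ^ 2 ≤ 1 := by linarith
      calc x ^ 2 * ‖X x‖ ≤
          x ^ 2 * ((‖σ‖ + (ℓ + 3) * (1 - x ^ 2) / x ^ 2) * ‖w x‖ + ‖κ‖ * ‖u x‖ / x) := by gcongr
        _ = (‖σ‖ * x ^ 2 + (ℓ + 3) * (1 - x ^ 2)) * ‖w x‖ + ‖κ‖ * (x * ‖u x‖) := by
          field_simp
        _ ≤ (‖σ‖ * 1 + (ℓ + 3) * 1) * K + ‖κ‖ * K := by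
          gcongr
          linarith [sq_nonneg x]
        _ = _ := by ring
    calc |Q x| = x ^ 4 * R x * |(σ * g x * (starRingEnd ℂ) (X x)).re| := by
          simp only [hQdef]
          rw [abs_mul, abs_of_pos (by positivity)]
      _ ≤ x ^ 4 * R x * (‖σ‖ * ‖g x‖ * ‖X x‖) := by
          gcongr
          simpa using Complex.abs_re_le_norm (σ * g x * (starRingEnd ℂ) (X x))
      _ = x * R x * (‖σ‖ * (x * ‖g x‖) * (x ^ 2 * ‖X x‖)) := by ring
      _ ≤ x * R x * (‖σ‖ * K * ((‖σ‖ + (ℓ + 3)) * K + ‖κ‖ * K)) := by gcongr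
      _ = _ := by ring
  have hcont : Continuous fun x : ℝ => M * (x * R x) := by
    have : Continuous R := by
      simp only [hRdef]
      exact (by fun_prop : Continuous fun x : ℝ => 1 - x ^ 2).rpow_const fun _ => Or.inr hσ.le
    fun_prop
  have hQ0 : ∀ x ∈ Ioo (0 : ℝ) 1, Q x = 0 := by
    intro x hx
    refine le_antisymm ?_ ?_
    · have hlim : Filter.Tendsto (fun y : ℝ => M * (y * R y)) (nhdsWithin 1 (Iio 1)) (nhds 0) := by
        have := hcont.tendsto 1
        simp only [hRdef, one_pow, sub_self, Real.zero_rpow hσ.ne', mul_zero] at this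
        exact this.mono_left nhdsWithin_le_nhds
      refine ge_of_tendsto hlim ?_
      filter_upwards [Ioo_mem_nhdsLT hx.2] with y hy
      have hy' : y ∈ Ioo (0 : ℝ) 1 := ⟨hx.1.trans hy.1, hy.2⟩
      exact (hmono hx hy' hy.1.le).trans ((le_abs_self _).trans (hM y hy'))
    · have hlim : Filter.Tendsto (fun y : ℝ => -(M * (y * R y))) (nhdsWithin 0 (Ioi 0))
          (nhds 0) := by
        have := (hcont.tendsto 0).neg
        simp only [zero_mul, mul_zero, neg_zero] at this
        exact this.mono_left nhdsWithin_le_nhds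
      refine le_of_tendsto hlim ?_
      filter_upwards [Ioo_mem_nhdsGT hx.1] with y hy
      have hy' : y ∈ Ioo (0 : ℝ) 1 := ⟨hy.1, hy.2.trans hx.2⟩
      exact (neg_le_of_abs_le (hM y hy')).trans (hmono hy' hx hy.2.le)
  intro x hx
  have hx0 := hx.1
  have hp := one_sub_sq_pos_of_mem_Ioo hx
  have hRx := hR0 x hx
  have hQ'x : Q' x = 0 := by
    refine (hQ x hx).unique ((hasDerivAt_const x (0 : ℝ)).congr_of_eventuallyEq ?_)
    filter_upwards [isOpen_Ioo.mem_nhds hx] with y hy using hQ0 y hy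
  have hσ0 : 0 < Complex.normSq σ := Complex.normSq_pos.2 fun h => by simp [h] at hσ
  have h1 : (Complex.normSq σ + ℓ * (ℓ + 3) * (1 - x ^ 2) / x ^ 2) * Complex.normSq (g x) = 0 := by
    have h2 : 0 < x ^ 4 * (R x / (1 - x ^ 2)) * σ.re := by positivity
    have h3 := (mul_eq_zero.1 hQ'x).resolve_left h2.ne'
    have h4 := Complex.normSq_nonneg (X x)
    have h5 := Complex.normSq_nonneg (g x)
    have h6 : 0 ≤ (Complex.normSq σ + ℓ * (ℓ + 3) * (1 - x ^ 2) / x ^ 2) * Complex.normSq (g x) := by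
      positivity
    linarith
  have h7 : g x = 0 := by
    refine Complex.normSq_eq_zero.1 ((mul_eq_zero.1 h1).resolve_left ?_)
    positivity
  exact (div_eq_zero_iff.1 h7).resolve_right (hne x hx).1

end FirstOrderSystem

/-- If `Re λ > -1/2`, `ℓ ∈ ℕ₀`, and `u` is a nontrivial twice continuously
differentiable solution on `(0,1)` of the spectral ODE
`-(1-ρ²)u'' - (2/ρ)u' + 2(λ+2)ρu' + [(λ+1)(λ+2)-6]u + (ℓ(ℓ+1)/ρ²)u = 0`
with `∫_0^1 (|u'|² + |u|²)ρ² dρ < ∞`, then `(ℓ,λ) = (0,1)` or `(ℓ,λ) = (1,0)`. -/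
theorem stmt18 (lam : ℂ) (hlam : -1/2 < lam.re) (ℓ : ℕ) (u : ℝ → ℂ)
    (hu : ContDiffOn ℝ 2 u (Ioo 0 1))
    (hode : ∀ ρ ∈ Ioo (0:ℝ) 1,
      -(1 - (ρ:ℂ)^2) * deriv (deriv u) ρ - (2 / (ρ:ℂ)) * deriv u ρ
        + 2 * (lam + 2) * (ρ:ℂ) * deriv u ρ
        + ((lam + 1) * (lam + 2) - 6) * u ρ
        + ((ℓ:ℂ) * ((ℓ:ℂ) + 1) / (ρ:ℂ)^2) * u ρ = 0)
    (hint : IntegrableOn (fun ρ : ℝ => (‖deriv u ρ‖^2 + ‖u ρ‖^2) * ρ^2) (Ioo 0 1))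
    (hne : ∃ ρ ∈ Ioo (0:ℝ) 1, u ρ ≠ 0) :
    (ℓ = 0 ∧ lam = 1) ∨ (ℓ = 1 ∧ lam = 0) := by
  have hd1 : ∀ x ∈ Ioo (0 : ℝ) 1, HasDerivAt u (deriv u x) x := fun x hx =>
    ((hu.differentiableOn (by norm_num)).differentiableAt (isOpen_Ioo.mem_nhds hx)).hasDerivAt
  have hd2 : ∀ x ∈ Ioo (0 : ℝ) 1, HasDerivAt (deriv u) (deriv (deriv u) x) x := fun x hx =>
    (((hu.deriv_of_isOpen (m := 1) isOpen_Ioo (by norm_num)).differentiableOn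
      (by norm_num)).differentiableAt (isOpen_Ioo.mem_nhds hx)).hasDerivAt
  set w : ℝ → ℂ := fun x => deriv u x - ℓ / x * u x with hwdef
  have hsys : ∀ x, w x + ℓ / x * u x = deriv u x := fun x => by simp [hwdef]
  have hw : ∀ x ∈ Ioo (0 : ℝ) 1, HasDerivAt w (((2 * (lam + 1) * x
      - (ℓ + 2) * (1 - x ^ 2) / x) * w x
      + (((lam + 1) + ℓ + 3) * ((lam + 1) + ℓ - 2)) * u x) / (1 - x ^ 2)) x := by
    intro x hx
    have hx0 : (x : ℂ) ≠ 0 := by exact_mod_cast hx.1.ne'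
    have hp : (1 : ℂ) - (x : ℂ) ^ 2 ≠ 0 := by exact_mod_cast (one_sub_sq_pos_of_mem_Ioo hx).ne'
    have hid : HasDerivAt (fun y : ℝ => (y : ℂ)) 1 x := (hasDerivAt_id x).ofReal_comp
    refine ((hd2 x hx).sub (((hasDerivAt_const x (ℓ : ℂ)).div hid hx0).mul (hd1 x hx))).congr_deriv ?_
    have h1 := hode x hx
    simp only [hwdef, Pi.div_apply]
    field_simp at h1 ⊢
    linear_combination -h1
  have hw0 : ∀ x ∈ Ioo (0 : ℝ) 1, w x = 0 := by
    have hre : (lam + 1).re = lam.re + 1 := by simp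
    obtain ⟨K, -, hK⟩ := exists_norm_le_of_system (by rw [hre]; linarith)
      (fun x hx => (hsys x).symm ▸ hd1 x hx) hw (by simpa only [hsys] using hint)
    exact eq_zero_of_system (by rw [hre]; linarith) rfl
      (fun x hx => (hsys x).symm ▸ hd1 x hx) hw hK
  obtain ⟨x, hx, hux⟩ := hne
  have hwx : HasDerivAt w 0 x := by
    refine (hasDerivAt_const x (0 : ℂ)).congr_of_eventuallyEq ?_
    filter_upwards [isOpen_Ioo.mem_nhds hx] with y hy using hw0 y hy
  have hp : (1 : ℂ) - (x : ℂ) ^ 2 ≠ 0 := by exact_mod_cast (one_sub_sq_pos_of_mem_Ioo hx).ne'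
  have hκ := (hw x hx).unique hwx
  rw [hw0 x hx, mul_zero, zero_add, div_eq_zero_iff, or_iff_left hp, mul_eq_zero,
    or_iff_left hux, mul_eq_zero] at hκ
  have hℓ : (0 : ℝ) ≤ ℓ := Nat.cast_nonneg _
  rcases hκ with h | h
  · have := congrArg Complex.re h
    simp at this
    linarith
  · have h1 := congrArg Complex.re h
    simp at h1
    have h2 : ℓ < 2 := by
      have : (ℓ : ℝ) < 2 := by linarith
      exact_mod_cast this
    interval_cases ℓ
    · left
      refine ⟨rfl, ?_⟩
      push_cast at h
      linear_combination h
    · right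
      refine ⟨rfl, ?_⟩
      push_cast at h
      linear_combination h
end
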